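/- arXiv:1406.4075 — 2 statements merged into one kernel-verified Lean document; each statement's English description precedes it below -/
import Mathlib

section
/- Let T be a minimal interval exchange transformation on [ℓ,r) defined over ℤ[√d]. There exists a constant C > 0 such that whenever z ∈ [ℓ,r), J ⊆ [ℓ,r) is a semi-interval with endpoints in ℤ[√d], and m, n ≥ 1 are integers with {T^i(z) : −m+1 ≤ i ≤ n−1} ∩ J = ∅, then |J| ≤ C/max(m,n). -/
open Set MeasureTheory

noncomputable section

/-- Left endpoint `γ i` of the `i`-th exchanged semi-interval. -/
def sepPt {s : ℕ} (l : ℝ) (len : Fin s → ℝ) (i : Fin s) : ℝ :=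
  l + ∑ j ∈ Finset.univ.filter (fun j => j < i), len j

/-- Left endpoint `δ` of the image of the `i`-th exchanged semi-interval. -/
def imgPt {s : ℕ} (l : ℝ) (len : Fin s → ℝ) (π : Equiv.Perm (Fin s)) (i : Fin s) : ℝ :=
  l + ∑ j ∈ Finset.univ.filter (fun j => π j < π i), len j

/-- `T` is the `s`-interval exchange transformation on `[l,r)` with lengths `len`
and permutation `π`, extended by the identity outside `[l,r)`. -/
def IsIET (s : ℕ) (l r : ℝ) (len : Fin s → ℝ) (π : Equiv.Perm (Fin s))
    (T : Equiv.Perm ℝ) : Prop :=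
  l < r ∧ (∀ i, 0 < len i) ∧ (∑ i, len i) = r - l ∧
  (∀ z, z ∉ Set.Ico l r → T z = z) ∧
  ∀ i : Fin s, ∀ z ∈ Set.Ico (sepPt l len i) (sepPt l len i + len i),
    T z = z + (imgPt l len π i - sepPt l len i)

/-- The two-sided orbit `{T^n z : n ∈ ℤ}`. -/
def orbitZ (T : Equiv.Perm ℝ) (z : ℝ) : Set ℝ := {w | ∃ n : ℤ, (T ^ n) z = w}

/-- Regularity (idoc): the orbits of the nonzero separation points are infinite
and pairwise disjoint. -/
def IsRegularIET (s : ℕ) (l : ℝ) (len : Fin s → ℝ) (T : Equiv.Perm ℝ) : Prop :=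
  (∀ i : Fin s, (i : ℕ) ≠ 0 → (orbitZ T (sepPt l len i)).Infinite) ∧
  (∀ i j : Fin s, (i : ℕ) ≠ 0 → (j : ℕ) ≠ 0 → i ≠ j →
    Disjoint (orbitZ T (sepPt l len i)) (orbitZ T (sepPt l len j)))

/-- Minimality: every (two-sided) orbit of a point of `[l,r)` is dense in `[l,r)`. -/
def IsMinimalOn (T : Equiv.Perm ℝ) (l r : ℝ) : Prop :=
  ∀ z ∈ Set.Ico l r, Set.Ico l r ⊆ closure (orbitZ T z)

/-- First return time of `z` in `I` (defined via `sInf`; meaningful when `T` is minimal). -/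
def returnTime (T : Equiv.Perm ℝ) (I : Set ℝ) (z : ℝ) : ℕ :=
  sInf {n : ℕ | 0 < n ∧ (T ^ n) z ∈ I}

/-- The transformation induced by `T` on `I` (first-return map). -/
def inducedMap (T : Equiv.Perm ℝ) (I : Set ℝ) (z : ℝ) : ℝ :=
  (T ^ returnTime T I z) z

/-- The transformation induced by `T` on `[u,v)` is an interval exchange
transformation on `k` intervals with data `(lam, σ)`. -/
def InducedData (T : Equiv.Perm ℝ) (u v : ℝ) (k : ℕ) (lam : Fin k → ℝ)
    (σ : Equiv.Perm (Fin k)) : Prop :=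
  ∃ S : Equiv.Perm ℝ, IsIET k u v lam σ S ∧
    ∀ z ∈ Set.Ico u v, S z = inducedMap T (Set.Ico u v) z

/-- The semi-interval `[l,t)` is right admissible for `T`. -/
def RightAdmissible (s : ℕ) (l r : ℝ) (len : Fin s → ℝ) (T : Equiv.Perm ℝ)
    (t : ℝ) : Prop :=
  l < t ∧ t < r ∧ ∃ (i : Fin s) (k : ℤ), t = (T ^ k) (sepPt l len i) ∧
    (0 < k → ∀ h : ℤ, 0 < h → h < k → t < (T ^ h) (sepPt l len i)) ∧
    (k ≤ 0 → ∀ h : ℤ, k < h → h ≤ 0 → t < (T ^ h) (sepPt l len i))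

/-- `ρ⁺_{I,T}(z) = min {n > 0 : T^n z ∈ (u,v)}`. -/
def rhoPlusPt (T : Equiv.Perm ℝ) (u v z : ℝ) : ℕ :=
  sInf {n : ℕ | 0 < n ∧ (T ^ n) z ∈ Set.Ioo u v}

/-- `ρ⁻_{I,T}(z) = min {n ≥ 0 : T^{-n} z ∈ (u,v)}`. -/
def rhoMinusPt (T : Equiv.Perm ℝ) (u v z : ℝ) : ℕ :=
  sInf {n : ℕ | (T⁻¹ ^ n) z ∈ Set.Ioo u v}

/-- The set of neighbours `N_{I,T}(z)` of `z` with respect to `I = [u,v)` and `T`. -/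
def neighbours (T : Equiv.Perm ℝ) (u v z : ℝ) : Set ℝ :=
  {w | ∃ k : ℤ, -(rhoMinusPt T u v z : ℤ) ≤ k ∧ k < (rhoPlusPt T u v z : ℤ) ∧
    w = (T ^ k) z}

/-- The set of division points `Div(I,T)` of `I = [u,v)` with respect to `T`. -/
def divPoints (s : ℕ) (l : ℝ) (len : Fin s → ℝ) (T : Equiv.Perm ℝ)
    (u v : ℝ) : Set ℝ :=
  ⋃ i : Fin s, neighbours T u v (sepPt l len i)

/-- The semi-interval `[u,v) ⊆ [l,r)` is admissible for `T`. -/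
def Admissible (s : ℕ) (l r : ℝ) (len : Fin s → ℝ) (T : Equiv.Perm ℝ)
    (u v : ℝ) : Prop :=
  l ≤ u ∧ u < v ∧ v ≤ r ∧
  u ∈ divPoints s l len T u v ∪ {r} ∧ v ∈ divPoints s l len T u v ∪ {r}

/-- A bundled regular `s`-interval exchange transformation. -/
structure RIET (s : ℕ) where
  l : ℝ
  r : ℝ
  len : Fin s → ℝ
  perm : Equiv.Perm (Fin s)
  T : Equiv.Perm ℝ
  isIET : IsIET s l r len perm T
  isReg : IsRegularIET s l len T

/-- The right endpoint `max (γ_s, δ_{π(s)})` of `Z(T)`. -/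
def zPoint {s : ℕ} (X : RIET s) : ℝ :=
  if h : 0 < s then
    max (sepPt X.l X.len ⟨s - 1, by omega⟩)
      (imgPt X.l X.len X.perm (X.perm.symm ⟨s - 1, by omega⟩))
  else X.r

/-- The left endpoint `min (γ_2, δ_{π(2)})` of `Y(T)`. -/
def yPoint {s : ℕ} (X : RIET s) : ℝ :=
  if h : 1 < s then
    min (sepPt X.l X.len ⟨1, h⟩) (imgPt X.l X.len X.perm (X.perm.symm ⟨1, h⟩))
  else X.l

/-- `Y = ψ(X)`: one step of the right Rauzy induction. -/
def PsiStep {s : ℕ} (X Y : RIET s) : Prop :=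
  Y.l = X.l ∧ Y.r = zPoint X ∧
  ∀ z ∈ Set.Ico X.l (zPoint X), Y.T z = inducedMap X.T (Set.Ico X.l (zPoint X)) z

/-- `Y = φ(X)`: one step of the left Rauzy induction. -/
def PhiStep {s : ℕ} (X Y : RIET s) : Prop :=
  Y.l = yPoint X ∧ Y.r = X.r ∧
  ∀ z ∈ Set.Ico (yPoint X) X.r, Y.T z = inducedMap X.T (Set.Ico (yPoint X) X.r) z

/-- Equivalence of two `s`-interval exchange transformations: `(σ, mu)` is obtained
from `(π, lam)` by rescaling, possibly combined with the reversal `τ : i ↦ s - i + 1`. -/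
def IETEquiv (s : ℕ) (π σ : Equiv.Perm (Fin s)) (lam mu : Fin s → ℝ) : Prop :=
  (∃ c : ℝ, 0 < c ∧ σ = π ∧ ∀ i, mu i = c * lam i) ∨
  (∃ c : ℝ, 0 < c ∧ (∀ i, σ i = (π i).rev) ∧ ∀ i, mu i = c * lam i.rev)

/-- The subring `ℤ[√d]` of `ℝ`. -/
def Zsd (d : ℤ) : Set ℝ := {z | ∃ m n : ℤ, z = (m : ℝ) + (n : ℝ) * Real.sqrt d}

/-- `Ψ(z) = max (|m|,|n|)` for `z = m + n√d` (the representation being unique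
when `d ≥ 2` is squarefree). -/
def PsiNum (d : ℤ) (z : ℝ) : ℕ :=
  sInf {k : ℕ | ∃ m n : ℤ, z = (m : ℝ) + (n : ℝ) * Real.sqrt d ∧
    k = max m.natAbs n.natAbs}

/-- `Ψ(S) = max {Ψ(z) : z ∈ ∂S}`. -/
def PsiSet (d : ℤ) (S : Set ℝ) : ℕ := sSup (PsiNum d '' frontier S)

/-- The reduced complexity `Π(S) = |S| ⬝ Ψ(S)`. -/
def PiSet (d : ℤ) (S : Set ℝ) : ℝ := (volume S).toReal * PsiSet d S

/-- `S` belongs to the algebra `A([l,r))`: a nonempty finite union of semi-intervals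
of `[l,r)` with endpoints in `ℤ[√d]`. -/
def MemA (d : ℤ) (l r : ℝ) (S : Set ℝ) : Prop :=
  S.Nonempty ∧ S ⊆ Set.Ico l r ∧
  ∃ (k : ℕ) (a b : Fin k → ℝ), (∀ j, a j ∈ Zsd d ∧ b j ∈ Zsd d ∧ a j < b j) ∧
    S = ⋃ j, Set.Ico (a j) (b j)

/-- The interval exchange transformation with data `(l, r, len, π)` is defined over
`ℤ[√d]`: `l`, `r`, the separation points and the translation values lie in `ℤ[√d]`. -/
def DefinedOverZ (d : ℤ) (s : ℕ) (l r : ℝ) (len : Fin s → ℝ)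
    (π : Equiv.Perm (Fin s)) : Prop :=
  l ∈ Zsd d ∧ r ∈ Zsd d ∧
  ∀ i, sepPt l len i ∈ Zsd d ∧ (imgPt l len π i - sepPt l len i) ∈ Zsd d

/-- Maximal positive return time `ρ⁺(S)`. -/
def rhoPlusSet (T : Equiv.Perm ℝ) (S : Set ℝ) : ℕ :=
  sInf {n : ℕ | 1 ≤ n ∧ ⇑(T ^ n) '' S ⊆ ⋃ i ∈ Finset.range n, ⇑(T ^ i) '' S}

/-- Maximal negative return time `ρ⁻(S)`. -/
def rhoMinusSet (T : Equiv.Perm ℝ) (S : Set ℝ) : ℕ :=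
  sInf {m : ℕ | 1 ≤ m ∧ ⇑(T ^ m) '' S ⊆ ⋃ i ∈ Finset.range m, ⇑(T⁻¹ ^ i) '' S}

/-- Minimal positive return time `σ⁺(S)`. -/
def sigmaPlusSet (T : Equiv.Perm ℝ) (S : Set ℝ) : ℕ :=
  sInf {n : ℕ | 1 ≤ n ∧ (⇑(T ^ n) '' S ∩ S).Nonempty}

/-- Minimal negative return time `σ⁻(S)`. -/
def sigmaMinusSet (T : Equiv.Perm ℝ) (S : Set ℝ) : ℕ :=
  sInf {m : ℕ | 1 ≤ m ∧ (⇑(T⁻¹ ^ m) '' S ∩ S).Nonempty}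

/-- `D_{m,n}(T) = ⋃_{i=-m+1}^{n} T^i (Sep(T))`. -/
def Dmn (s : ℕ) (l : ℝ) (len : Fin s → ℝ) (T : Equiv.Perm ℝ) (m n : ℕ) : Set ℝ :=
  {w | ∃ (i : Fin s) (k : ℤ), -(m : ℤ) + 1 ≤ k ∧ k ≤ (n : ℤ) ∧
    w = (T ^ k) (sepPt l len i)}

/-- `[u,v)` belongs to `U(T) = ⋃_{m,n ≥ 1} U_{m,n}(T)`: it is one of the
semi-intervals into which `D_{m,n}(T)` partitions `[l,r)`. -/
def MemU (s : ℕ) (l r : ℝ) (len : Fin s → ℝ) (T : Equiv.Perm ℝ) (u v : ℝ) : Prop :=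
  ∃ m n : ℕ, 1 ≤ m ∧ 1 ≤ n ∧ u ∈ Dmn s l len T m n ∧
    (v ∈ Dmn s l len T m n ∨ v = r) ∧ ∀ w ∈ Dmn s l len T m n, w ∉ Set.Ioo u v

/-- `x = m + n√d` lies in `ℤ[√d]` and its algebraic conjugate `m - n√d` is at most `B`
in absolute value. -/
def ConjBound (d : ℤ) (B x : ℝ) : Prop :=
  ∃ m n : ℤ, x = (m : ℝ) + (n : ℝ) * Real.sqrt d ∧ |(m : ℝ) - (n : ℝ) * Real.sqrt d| ≤ B

namespace ConjBound

variable {d : ℤ} {B B' x y : ℝ}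

lemma mono (h : ConjBound d B x) (hB : B ≤ B') : ConjBound d B' x := by
  obtain ⟨m, n, hx, hb⟩ := h
  exact ⟨m, n, hx, hb.trans hB⟩

lemma add (hx : ConjBound d B x) (hy : ConjBound d B' y) : ConjBound d (B + B') (x + y) := by
  obtain ⟨m, n, rfl, hb⟩ := hx
  obtain ⟨m', n', rfl, hb'⟩ := hy
  refine ⟨m + m', n + n', by push_cast; ring, ?_⟩
  refine le_trans (le_of_eq ?_) ((abs_add_le _ _).trans (add_le_add hb hb'))
  congr 1; push_cast; ring

lemma neg (hx : ConjBound d B x) : ConjBound d B (-x) := by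
  obtain ⟨m, n, rfl, hb⟩ := hx
  refine ⟨-m, -n, by push_cast; ring, ?_⟩
  rw [← abs_neg] at hb
  refine le_trans (le_of_eq ?_) hb
  congr 1; push_cast; ring

lemma sub (hx : ConjBound d B x) (hy : ConjBound d B' y) : ConjBound d (B + B') (x - y) := by
  simpa only [sub_eq_add_neg] using hx.add hy.neg

lemma mul (hd : 0 ≤ d) (hx : ConjBound d B x) (hy : ConjBound d B' y) :
    ConjBound d (B * B') (x * y) := by
  have hs : Real.sqrt d * Real.sqrt d = d := Real.mul_self_sqrt (by exact_mod_cast hd)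
  obtain ⟨m, n, rfl, hb⟩ := hx
  obtain ⟨m', n', rfl, hb'⟩ := hy
  refine ⟨m * m' + d * n * n', m * n' + n * m', ?_, ?_⟩
  · push_cast
    linear_combination (n * n' : ℝ) * hs
  · have h := mul_le_mul hb hb' (abs_nonneg _) ((abs_nonneg _).trans hb)
    rw [← abs_mul] at h
    refine le_trans (le_of_eq ?_) h
    congr 1
    push_cast
    linear_combination -(n * n' : ℝ) * hs

lemma pow (hd : 0 ≤ d) (hx : ConjBound d B x) (k : ℕ) : ConjBound d (B ^ k) (x ^ k) := by
  induction k with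
  | zero => exact ⟨1, 0, by simp, by simp⟩
  | succ k ih =>
    rw [pow_succ, pow_succ]
    exact ih.mul hd hx

/-- A positive element of `ℤ[√d]` is bounded below by the inverse of its conjugate. -/
lemma one_le_mul (hd : 0 ≤ d) (hns : ¬ IsSquare d) (hx : ConjBound d B x) (hpos : 0 < x) :
    1 ≤ x * B := by
  have hs : Real.sqrt d * Real.sqrt d = d := Real.mul_self_sqrt (by exact_mod_cast hd)
  obtain ⟨m, n, rfl, hb⟩ := hx
  have hne : m ^ 2 - d * n ^ 2 ≠ 0 := by
    intro h
    by_cases hn : n = 0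
    · subst hn
      have : m = 0 := by simpa using h
      subst this
      simp at hpos
    · have hdvd : n ^ 2 ∣ m ^ 2 := ⟨d, by linarith⟩
      obtain ⟨k, rfl⟩ := (Int.pow_dvd_pow_iff two_ne_zero).1 hdvd
      apply hns
      refine ⟨k, ?_⟩
      have hn2 : n ^ 2 ≠ 0 := pow_ne_zero _ hn
      apply mul_left_cancel₀ hn2
      linarith
  have h1 : (1 : ℝ) ≤ |((m ^ 2 - d * n ^ 2 : ℤ) : ℝ)| := by
    exact_mod_cast Int.one_le_abs hne
  have h2 : ((m ^ 2 - d * n ^ 2 : ℤ) : ℝ)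
      = ((m : ℝ) + n * Real.sqrt d) * ((m : ℝ) - n * Real.sqrt d) := by
    push_cast
    linear_combination (n ^ 2 : ℝ) * hs
  rw [h2, abs_mul, abs_of_pos hpos] at h1
  exact h1.trans (mul_le_mul_of_nonneg_left hb hpos.le)

end ConjBound

lemma not_isSquare_of_squarefree {d : ℤ} (hd : 2 ≤ d) (hsf : Squarefree d) : ¬ IsSquare d := by
  rintro ⟨k, rfl⟩
  have hu := hsf k dvd_rfl
  rcases Int.isUnit_iff.1 hu with rfl | rfl <;> norm_num at hd

/-- Every point is close to an element of `ℤ[√d]` with bounded conjugate. -/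
lemma exists_conjBound_near {d : ℤ} (hd : 0 < d) (A : ℝ) :
    ∃ y, A ≤ y ∧ y < A + (1 + Real.sqrt d) ∧ ConjBound d (1 + Real.sqrt d) y := by
  have hs : 0 < Real.sqrt d := Real.sqrt_pos.2 (by exact_mod_cast hd)
  set n : ℤ := ⌈A / (2 * Real.sqrt d)⌉
  set m : ℤ := ⌈A / 2⌉
  have hn1 : A / 2 ≤ n * Real.sqrt d := by
    have := Int.le_ceil (A / (2 * Real.sqrt d))
    rw [div_le_iff₀ (by positivity)] at this
    linarith
  have hn2 : n * Real.sqrt d < A / 2 + Real.sqrt d := by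
    have := Int.ceil_lt_add_one (A / (2 * Real.sqrt d))
    have h := mul_lt_mul_of_pos_right this hs
    have e : (A / (2 * Real.sqrt d) + 1) * Real.sqrt d = A / 2 + Real.sqrt d := by
      field_simp
    linarith
  have hm1 : A / 2 ≤ m := Int.le_ceil _
  have hm2 : (m : ℝ) < A / 2 + 1 := Int.ceil_lt_add_one _
  refine ⟨m + n * Real.sqrt d, by linarith, by linarith, m, n, rfl, ?_⟩
  rw [abs_le]
  constructor <;> linarith

/-- Pell units: there is `η > 1` such that `η⁻¹` lies in `ℤ[√d]` and has conjugate `η`. -/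
lemma exists_unit_conjBound {d : ℤ} (hd : 0 < d) (hns : ¬ IsSquare d) :
    ∃ η : ℝ, 1 < η ∧ ConjBound d η η⁻¹ := by
  obtain ⟨x, y, hxy, hy⟩ := Pell.exists_of_not_isSquare hd hns
  have hs : Real.sqrt d * Real.sqrt d = d :=
    Real.mul_self_sqrt (by exact_mod_cast hd.le)
  have hs0 : 0 < Real.sqrt d := Real.sqrt_pos.2 (by exact_mod_cast hd)
  have hx1 : 1 ≤ |x| := by
    apply Int.one_le_abs
    rintro rfl
    nlinarith [sq_nonneg y]
  have hy1 : 1 ≤ |y| := Int.one_le_abs hy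
  have hx1' : (1 : ℝ) ≤ ((|x| : ℤ) : ℝ) := by exact_mod_cast hx1
  have hy1' : (1 : ℝ) ≤ ((|y| : ℤ) : ℝ) := by exact_mod_cast hy1
  have hlt : 1 < ((|x| : ℤ) : ℝ) + ((|y| : ℤ) : ℝ) * Real.sqrt d := by nlinarith
  have hnorm : (((|x| : ℤ) : ℝ) + ((|y| : ℤ) : ℝ) * Real.sqrt d)
      * (((|x| : ℤ) : ℝ) - ((|y| : ℤ) : ℝ) * Real.sqrt d) = 1 := by
    have h : ((|x| : ℤ) : ℝ) ^ 2 - d * ((|y| : ℤ) : ℝ) ^ 2 = 1 := by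
      rw [← sq_abs x, ← sq_abs y] at hxy
      exact_mod_cast hxy
    linear_combination h - (((|y| : ℤ) : ℝ) ^ 2) * hs
  refine ⟨_, hlt, |x|, -|y|, ?_, ?_⟩
  · refine inv_eq_of_mul_eq_one_right (Eq.trans ?_ hnorm)
    push_cast; ring
  · rw [abs_of_pos]
    · push_cast; linarith
    · push_cast at hlt ⊢; linarith

/-- Semi-intervals of length `δ` contain elements of `ℤ[√d]` with conjugate `O(1/δ)`. -/
lemma exists_conjBound_mem_Ico {d : ℤ} (hd : 0 < d) (hns : ¬ IsSquare d) (R : ℝ) (hR : 0 < R) :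
    ∃ C : ℝ, 0 < C ∧ ∀ a δ : ℝ, 0 < δ → δ ≤ R →
      ∃ x ∈ Set.Ico a (a + δ), ConjBound d (C / δ) x := by
  obtain ⟨η, hη, hconj⟩ := exists_unit_conjBound hd hns
  have hs0 : 0 < Real.sqrt d := Real.sqrt_pos.2 (by exact_mod_cast hd)
  set L : ℝ := 1 + Real.sqrt d with hL
  refine ⟨η * (L + R) * L, by positivity, fun a δ hδ hδR => ?_⟩
  have h1 : 1 ≤ (L + R) / δ := by
    rw [le_div_iff₀ hδ]; linarith
  obtain ⟨k, hk1, hk2⟩ := exists_nat_pow_near h1 hη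
  have hηpos : 0 < η := by linarith
  have hp : 0 < η ^ (k + 1) := by positivity
  obtain ⟨y, hy1, hy2, hy3⟩ := exists_conjBound_near hd (η ^ (k + 1) * a)
  refine ⟨(η⁻¹) ^ (k + 1) * y, ⟨?_, ?_⟩, ?_⟩
  · rw [inv_pow, inv_mul_eq_div, le_div_iff₀ hp]; linarith
  · rw [inv_pow, inv_mul_eq_div, div_lt_iff₀ hp]
    rw [div_lt_iff₀ hδ] at hk2
    nlinarith
  · refine ((hconj.pow hd.le (k + 1)).mul hd.le hy3).mono ?_
    have : η ^ (k + 1) ≤ η * ((L + R) / δ) := by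
      rw [pow_succ']; exact mul_le_mul_of_nonneg_left hk1 hηpos.le
    calc η ^ (k + 1) * L ≤ η * ((L + R) / δ) * L :=
          mul_le_mul_of_nonneg_right this (by positivity)
      _ = η * (L + R) * L / δ := by ring

lemma exists_conjBound_of_mem_Zsd {d : ℤ} {ι : Type*} [Finite ι] (f : ι → ℝ)
    (hf : ∀ i, f i ∈ Zsd d) : ∃ M : ℝ, 0 < M ∧ ∀ i, ConjBound d M (f i) := by
  choose m n h using hf
  obtain ⟨M, hM⟩ := (Set.finite_range fun i => |(m i : ℝ) - n i * Real.sqrt d|).bddAbove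
  refine ⟨max M 1, by positivity, fun i => ⟨m i, n i, h i, ?_⟩⟩
  exact (hM ⟨i, rfl⟩).trans (le_max_left _ _)

/-- The cell of `x` in the partition of `[l,r)` by a finite set of points. -/
lemma exists_cell {l r x : ℝ} (E : Finset ℝ) (hl : l ∈ E) (hr : r ∈ E)
    (hx : x ∈ Set.Ico l r) :
    ∃ e ∈ E, ∃ e' ∈ E, e ≤ x ∧ x < e' ∧ ∀ y, e ≤ y → y < e' → ∀ f ∈ E, f ≤ x ↔ f ≤ y := by
  obtain ⟨e, he, hemax⟩ := (E.filter (· ≤ x)).exists_max_image id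
    ⟨l, Finset.mem_filter.2 ⟨hl, hx.1⟩⟩
  obtain ⟨e', he', hemin⟩ := (E.filter (x < ·)).exists_min_image id
    ⟨r, Finset.mem_filter.2 ⟨hr, hx.2⟩⟩
  rw [Finset.mem_filter] at he he'
  refine ⟨e, he.1, e', he'.1, he.2, he'.2, fun y hy1 hy2 f hf => ⟨fun h => ?_, fun h => ?_⟩⟩
  · exact (hemax f (Finset.mem_filter.2 ⟨hf, h⟩)).trans hy1
  · by_contra! hlt
    have := hemin f (Finset.mem_filter.2 ⟨hf, hlt⟩)
    simp only [id] at this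
    linarith

/-- Around each `w` there is a semi-interval, not shorter than the inverse of a linear function
of `k`, on which the first `k` iterates of `T` are translations that respect the partition
by `E`. -/
lemma exists_long_cell {d : ℤ} (hd : 0 ≤ d) (hns : ¬ IsSquare d) {l r B M : ℝ}
    {T : Equiv.Perm ℝ} (E : Finset ℝ)
    (hl : l ∈ E) (hr : r ∈ E) (hE : ∀ e ∈ E, ConjBound d B e)
    (hmaps : ∀ x ∈ Set.Ico l r, T x ∈ Set.Ico l r)
    (htrans : ∀ x y, (∀ e ∈ E, e ≤ x ↔ e ≤ y) → x ∈ Set.Ico l r → T y - y = T x - x)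
    (hconj : ∀ x ∈ Set.Ico l r, ConjBound d M (T x - x)) (hM : 0 ≤ M)
    (w : ℝ) (hw : w ∈ Set.Ico l r) (k : ℕ) :
    ∃ a b : ℝ, 1 ≤ (a + b) * (2 * B + 2 * k * M) ∧ ∀ t, -a ≤ t → t < b → ∀ i ≤ k,
      (T ^ i) (w + t) = (T ^ i) w + t ∧
      ∀ e ∈ E, e ≤ (T ^ i) w ↔ e ≤ (T ^ i) w + t := by
  have horb : ∀ i : ℕ, (T ^ i) w ∈ Set.Ico l r := by
    intro i
    induction i with
    | zero => simpa using hw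
    | succ i ih => rw [pow_succ', Equiv.Perm.mul_apply]; exact hmaps _ ih
  have hdisp : ∀ i : ℕ, ConjBound d (i * M) ((T ^ i) w - w) := by
    intro i
    induction i with
    | zero => exact ⟨0, 0, by simp, by simp⟩
    | succ i ih =>
      rw [pow_succ', Equiv.Perm.mul_apply]
      have := (hconj _ (horb i)).add ih
      rw [sub_add_sub_cancel] at this
      exact this.mono (by push_cast; linarith)
  choose e he e' he' hle hlt hcell using fun i : ℕ => exists_cell E hl hr (horb i)
  obtain ⟨i₀, hi₀, hi₀min⟩ := (Finset.range (k + 1)).exists_min_image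
    (fun i => (T ^ i) w - e i) ⟨0, by simp⟩
  obtain ⟨j₀, hj₀, hj₀min⟩ := (Finset.range (k + 1)).exists_min_image
    (fun i => e' i - (T ^ i) w) ⟨0, by simp⟩
  have hstep : ∀ t, -((T ^ i₀) w - e i₀) ≤ t → t < e' j₀ - (T ^ j₀) w → ∀ i ≤ k,
      ∀ f ∈ E, f ≤ (T ^ i) w ↔ f ≤ (T ^ i) w + t := by
    intro t ht1 ht2 i hi
    have h1 := hi₀min i (Finset.mem_range.2 (by omega))
    have h2 := hj₀min i (Finset.mem_range.2 (by omega))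
    exact hcell i _ (by linarith) (by linarith)
  refine ⟨(T ^ i₀) w - e i₀, e' j₀ - (T ^ j₀) w, ?_, fun t ht1 ht2 i hi =>
    ⟨?_, hstep t ht1 ht2 i hi⟩⟩
  · have hpos : 0 < (T ^ i₀) w - e i₀ + (e' j₀ - (T ^ j₀) w) := by
      linarith [hle i₀, hlt j₀]
    refine ConjBound.one_le_mul hd hns ?_ hpos
    have h := ((hE _ (he' j₀)).sub (hE _ (he i₀))).add ((hdisp i₀).sub (hdisp j₀))
    have e1 : e' j₀ - e i₀ + ((T ^ i₀) w - w - ((T ^ j₀) w - w))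
        = (T ^ i₀) w - e i₀ + (e' j₀ - (T ^ j₀) w) := by ring
    rw [e1] at h
    refine h.mono ?_
    have hi : (i₀ : ℝ) ≤ k := by
      exact_mod_cast Nat.lt_succ_iff.1 (Finset.mem_range.1 hi₀)
    have hj : (j₀ : ℝ) ≤ k := by
      exact_mod_cast Nat.lt_succ_iff.1 (Finset.mem_range.1 hj₀)
    nlinarith
  · induction i with
    | zero => simp
    | succ i ih =>
      rw [pow_succ', Equiv.Perm.mul_apply, Equiv.Perm.mul_apply, ih (by omega)]
      have := htrans _ _ (hstep t ht1 ht2 i (by omega)) (horb i)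
      linarith

lemma log_le_sum_inv {K : ℝ} (hK : 0 < K) (N : ℕ) :
    Real.log ((K + N) / K) ≤ ∑ i ∈ Finset.range N, 1 / (K + i) := by
  induction N with
  | zero => simp [hK.ne']
  | succ N ih =>
    rw [Finset.sum_range_succ]
    have hp : 0 < K + N := by positivity
    have h : Real.log ((K + (N + 1 : ℕ)) / (K + N)) ≤ 1 / (K + N) := by
      refine (Real.log_le_sub_one_of_pos (by positivity)).trans (le_of_eq ?_)
      push_cast; field_simp; ring
    have h2 : (K + (N + 1 : ℕ)) / K = (K + N) / K * ((K + (N + 1 : ℕ)) / (K + N)) := by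
      field_simp
    rw [h2, Real.log_mul (by positivity) (by positivity)]
    linarith

lemma sum_length_le {l r : ℝ} (hlr : l ≤ r) (N : ℕ) (a b : ℕ → ℝ) (h : ∀ i, a i ≤ b i)
    (hsub : ∀ i < N, Set.Ico (a i) (b i) ⊆ Set.Ico l r)
    (hdisj : ∀ j < N, ∀ i < j, Disjoint (Set.Ico (a i) (b i)) (Set.Ico (a j) (b j))) :
    ∑ i ∈ Finset.range N, (b i - a i) ≤ r - l := by
  have hd : (Finset.range N : Set ℕ).PairwiseDisjoint fun i => Set.Ico (a i) (b i) := by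
    intro i hi j hj hij
    simp only [Finset.coe_range, Set.mem_Iio] at hi hj
    rcases lt_or_gt_of_ne hij with h | h
    · exact hdisj j hj i h
    · exact (hdisj i hi j h).symm
  have h1 := measure_biUnion_finset (μ := volume) hd fun i _ => measurableSet_Ico
  have h2 : volume (⋃ i ∈ Finset.range N, Set.Ico (a i) (b i)) ≤ volume (Set.Ico l r) :=
    measure_mono (Set.iUnion₂_subset fun i hi => hsub i (Finset.mem_range.1 hi))
  rw [h1, Real.volume_Ico] at h2
  simp only [Real.volume_Ico] at h2
  rw [← ENNReal.ofReal_sum_of_nonneg (fun i _ => sub_nonneg.2 (h i))] at h2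
  exact (ENNReal.ofReal_le_ofReal_iff (by linarith)).1 h2

/-- Disjoint semi-intervals of harmonic lengths: there cannot be too many. -/
lemma card_le_of_harmonic_lengths {l r K D : ℝ} (hlr : l ≤ r) (hK : 0 < K) (hD : 0 < D)
    (N : ℕ) (a b : ℕ → ℝ)
    (hlen : ∀ i, 1 ≤ (b i - a i) * (D * (K + i)))
    (hsub : ∀ i < N, Set.Ico (a i) (b i) ⊆ Set.Ico l r)
    (hdisj : ∀ j < N, ∀ i < j, Disjoint (Set.Ico (a i) (b i)) (Set.Ico (a j) (b j))) :
    N ≤ Real.exp (D * (r - l)) * K := by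
  have hlen' : ∀ i, 1 / (K + i) ≤ D * (b i - a i) := by
    intro i
    rw [div_le_iff₀ (by positivity)]
    linarith [hlen i]
  have hab : ∀ i, a i ≤ b i := by
    intro i
    have h : 0 < 1 / (K + i) := by positivity
    have := pos_of_mul_pos_right (h.trans_le (hlen' i)) hD.le
    linarith
  have h1 := sum_length_le hlr N a b hab hsub hdisj
  have h2 : Real.log ((K + N) / K) ≤ D * (r - l) := by
    refine (log_le_sum_inv hK N).trans ((Finset.sum_le_sum fun i _ => hlen' i).trans ?_)
    rw [← Finset.mul_sum]
    exact mul_le_mul_of_nonneg_left h1 hD.le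
  rw [Real.log_le_iff_le_exp (by positivity), div_le_iff₀ hK] at h2
  linarith

section Exchange

variable {s : ℕ} {l r : ℝ} {len : Fin s → ℝ}

lemma sepPt_add_len (hsum : ∑ i, len i = r - l) (i : Fin s) :
    sepPt l len i + len i = r ∨ ∃ j, i < j ∧ sepPt l len i + len i = sepPt l len j := by
  have key : sepPt l len i + len i = l + ∑ j ∈ Finset.univ.filter (fun j => j ≤ i), len j := by
    have : Finset.univ.filter (fun j => j ≤ i)
        = insert i (Finset.univ.filter (fun j => j < i)) := by
      ext j; simp [le_iff_eq_or_lt]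
    rw [this, Finset.sum_insert (by simp), sepPt]
    ring
  by_cases hi : (i : ℕ) + 1 < s
  · right
    refine ⟨⟨i + 1, hi⟩, by simp [Fin.lt_def], ?_⟩
    rw [key, sepPt]
    refine congrArg (l + ·) (Finset.sum_congr (Finset.filter_congr fun j _ => ?_) fun _ _ => rfl)
    rw [Fin.le_def, Fin.lt_def]
    exact Nat.lt_succ_iff.symm
  · left
    rw [key, Finset.filter_true_of_mem, hsum]
    · ring
    · intro j _
      rw [Fin.le_def]; omega

lemma exists_mem_exchanged (hlr : l < r) (hsum : ∑ i, len i = r - l) {x : ℝ}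
    (hx : x ∈ Set.Ico l r) :
    ∃ i, x ∈ Set.Ico (sepPt l len i) (sepPt l len i + len i) := by
  have hs : 0 < s := by
    rcases Nat.eq_zero_or_pos s with rfl | h
    · simp at hsum; linarith
    · exact h
  have h0 : sepPt l len ⟨0, hs⟩ = l := by
    simp [sepPt, Fin.lt_def]
  obtain ⟨i, hi, hmax⟩ := (Finset.univ.filter (fun i => sepPt l len i ≤ x)).exists_max_image id
    ⟨⟨0, hs⟩, Finset.mem_filter.2 ⟨Finset.mem_univ _, by rw [h0]; exact hx.1⟩⟩
  rw [Finset.mem_filter] at hi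
  refine ⟨i, hi.2, ?_⟩
  rcases sepPt_add_len hsum i with h | ⟨j, hij, h⟩
  · rw [h]; exact hx.2
  · by_contra! hle
    have := hmax j (Finset.mem_filter.2 ⟨Finset.mem_univ _, by rw [← h]; exact hle⟩)
    exact absurd hij (not_lt.2 this)

end Exchange

lemma perm_apply_mem_of_fixed_compl {X : Type*} {T : Equiv.Perm X} {S : Set X}
    (h : ∀ z, z ∉ S → T z = z) {x : X} (hx : x ∈ S) : T x ∈ S := by
  by_contra hn
  rw [T.injective (h _ hn)] at hn
  exact hn hx

/-- Quantitative recurrence: an orbit segment avoiding a semi-interval whose endpoints belong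
to the partition `E` is short. -/
lemma card_avoiding_le {d : ℤ} (hd : 0 ≤ d) (hns : ¬ IsSquare d) {l r B M K D u v : ℝ}
    {T : Equiv.Perm ℝ} (E : Finset ℝ)
    (hl : l ∈ E) (hr : r ∈ E) (hu : u ∈ E) (hv : v ∈ E) (hE : ∀ e ∈ E, ConjBound d B e)
    (hlr : l ≤ r)
    (hfix : ∀ z, z ∉ Set.Ico l r → T z = z)
    (htrans : ∀ x y, (∀ e ∈ E, e ≤ x ↔ e ≤ y) → x ∈ Set.Ico l r → T y - y = T x - x)
    (hconj : ∀ x ∈ Set.Ico l r, ConjBound d M (T x - x)) (hM : 0 ≤ M)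
    (hK : 0 < K) (hD : 0 < D) (hBK : 2 * B ≤ D * K) (hMD : 2 * M ≤ D)
    {z : ℝ} (hz : z ∈ Set.Ico l r) (N : ℕ)
    (havoid : ∀ i : ℕ, i < N → (T ^ i) z ∉ Set.Ico u v)
    (hhit : ∃ p : ℤ, (T ^ p) z ∈ Set.Ico u v) :
    N ≤ Real.exp (D * (r - l)) * K := by
  have hmaps : ∀ x ∈ Set.Ico l r, T x ∈ Set.Ico l r :=
    fun x => perm_apply_mem_of_fixed_compl hfix
  have horb : ∀ p : ℤ, (T ^ p) z ∈ Set.Ico l r := by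
    intro p
    induction p with
    | zero => simpa using hz
    | succ i ih =>
      rw [add_comm, zpow_one_add, Equiv.Perm.mul_apply]
      exact hmaps _ ih
    | pred i ih =>
      rw [sub_eq_neg_add, zpow_add, zpow_neg_one, Equiv.Perm.mul_apply]
      refine perm_apply_mem_of_fixed_compl (fun y hy => ?_) ih
      rw [Equiv.Perm.inv_eq_iff_eq, hfix y hy]
  have hmem : ∀ x y : ℝ, (∀ e ∈ E, e ≤ x ↔ e ≤ y) → ∀ {a b : ℝ}, a ∈ E → b ∈ E →
      (x ∈ Set.Ico a b ↔ y ∈ Set.Ico a b) := by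
    intro x y h a b ha hb
    rw [Set.mem_Ico, Set.mem_Ico, h a ha, ← not_le, ← not_le, h b hb]
  have hlen : ∀ (x : ℝ) (k : ℕ), 1 ≤ x * (2 * B + 2 * k * M) → 1 ≤ x * (D * (K + k)) := by
    intro x k h
    have hB : 0 ≤ B := by
      obtain ⟨m, n, -, h⟩ := hE l hl
      exact (abs_nonneg _).trans h
    have hk : (0 : ℝ) ≤ k := by positivity
    have h0 : 0 ≤ 2 * B + 2 * k * M := by positivity
    have hx : 0 ≤ x := by
      by_contra! hneg
      nlinarith
    refine h.trans (mul_le_mul_of_nonneg_left ?_ hx)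
    nlinarith
  have hcell := exists_long_cell hd hns E hl hr hE hmaps htrans hconj hM
  classical
  by_cases hpos : ∃ p : ℕ, (T ^ p) z ∈ Set.Ico u v
  · -- the orbit visits `[u,v)` in the future: use the sets with first hitting time `i`
    set p := Nat.find hpos
    have hp : (T ^ p) z ∈ Set.Ico u v := Nat.find_spec hpos
    have hpmin : ∀ q < p, (T ^ q) z ∉ Set.Ico u v := fun q => Nat.find_min hpos
    have hNp : N ≤ p := by
      by_contra! h
      exact havoid p h hp
    choose a b hab hc using fun i : ℕ =>
      hcell ((T ^ (p - i)) z) (by simpa using horb ((p - i : ℕ) : ℤ)) i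
    refine card_le_of_harmonic_lengths hlr hK hD N (fun i => (T ^ (p - i)) z - a i)
      (fun i => (T ^ (p - i)) z + b i) (fun i => ?_) (fun i hi x hx => ?_) (fun j hj i hij => ?_)
    · refine hlen _ _ ((hab i).trans_eq ?_)
      ring
    · have h := (hc i (x - (T ^ (p - i)) z) (by linarith [hx.1]) (by linarith [hx.2]) 0
        (Nat.zero_le _)).2
      rw [pow_zero, Equiv.Perm.one_apply, add_sub_cancel] at h
      exact (hmem _ _ h hl hr).1 (by simpa using horb ((p - i : ℕ) : ℤ))
    · rw [Set.disjoint_left]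
      intro x hxi hxj
      have h1 := hc i (x - (T ^ (p - i)) z) (by linarith [hxi.1]) (by linarith [hxi.2]) i le_rfl
      have h2 := hc j (x - (T ^ (p - j)) z) (by linarith [hxj.1]) (by linarith [hxj.2]) i hij.le
      rw [← h1.1, add_sub_cancel] at h1
      rw [← h2.1, add_sub_cancel] at h2
      have h3 := (hmem _ _ h1.2 hu hv).1 (by
        rw [← Equiv.Perm.mul_apply, ← pow_add, Nat.add_sub_cancel' (by omega)]; exact hp)
      have h4 := (hmem _ _ h2.2 hu hv).2 h3
      rw [← Equiv.Perm.mul_apply, ← pow_add] at h4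
      exact hpmin _ (by omega) h4
  · -- the orbit visits `[u,v)` only in the past: use the sets with last hitting time `i`
    have hneg : ∃ q : ℕ, (T ^ (-(q : ℤ))) z ∈ Set.Ico u v := by
      obtain ⟨p, hp⟩ := hhit
      obtain ⟨q, rfl | rfl⟩ := p.eq_nat_or_neg
      · exact absurd ⟨q, by simpa using hp⟩ hpos
      · exact ⟨q, hp⟩
    set q := Nat.find hneg
    have hq : (T ^ (-(q : ℤ))) z ∈ Set.Ico u v := Nat.find_spec hneg
    have hqmin : ∀ q' < q, (T ^ (-(q' : ℤ))) z ∉ Set.Ico u v := fun q' => Nat.find_min hneg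
    set y := (T ^ (-(q : ℤ))) z with hy
    have hyi : ∀ i : ℕ, 0 < i → (T ^ i) y ∉ Set.Ico u v := by
      intro i hi
      have e : (T ^ i) y = (T ^ ((i : ℤ) - q)) z := by
        rw [hy, ← zpow_natCast, ← Equiv.Perm.mul_apply, ← zpow_add, sub_eq_add_neg]
      rw [e]
      rcases le_or_gt q i with h | h
      · rw [← Nat.cast_sub h, zpow_natCast]
        exact fun h' => hpos ⟨_, h'⟩
      · have := hqmin (q - i) (by omega)
        rwa [Nat.cast_sub h.le, neg_sub] at this
    have hyorb : ∀ i : ℕ, (T ^ i) y ∈ Set.Ico l r := by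
      intro i
      rw [hy, ← zpow_natCast, ← Equiv.Perm.mul_apply, ← zpow_add]
      exact horb _
    choose a b hab hc using fun i : ℕ => hcell y (horb _) i
    refine card_le_of_harmonic_lengths hlr hK hD N (fun i => (T ^ i) y - a i)
      (fun i => (T ^ i) y + b i) (fun i => ?_) (fun i hi x hx => ?_) (fun j hj i hij => ?_)
    · refine hlen _ _ ((hab i).trans_eq ?_)
      ring
    · have h := (hc i (x - (T ^ i) y) (by linarith [hx.1]) (by linarith [hx.2]) i le_rfl).2
      rw [add_sub_cancel] at h
      exact (hmem _ _ h hl hr).1 (hyorb i)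
    · rw [Set.disjoint_left]
      intro x hxi hxj
      have ci := hc i (x - (T ^ i) y) (by linarith [hxi.1]) (by linarith [hxi.2])
      have cj := hc j (x - (T ^ j) y) (by linarith [hxj.1]) (by linarith [hxj.2])
      have hi1 := (ci i le_rfl).1
      have hi0 := (ci 0 (Nat.zero_le _)).2
      have hj1 := (cj j le_rfl).1
      have hj2 := cj (j - i) (Nat.sub_le _ _)
      rw [add_sub_cancel] at hi1 hj1
      rw [pow_zero, Equiv.Perm.one_apply] at hi0
      rw [← hj2.1] at hj2
      have e : (T ^ (j - i)) (y + (x - (T ^ j) y)) = y + (x - (T ^ i) y) := by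
        apply (T ^ i).injective
        rw [hi1, ← Equiv.Perm.mul_apply, ← pow_add, Nat.add_sub_cancel' hij.le, hj1]
      rw [e] at hj2
      exact hyi (j - i) (by omega)
        ((hmem _ _ hj2.2 hu hv).2 ((hmem _ _ hi0 hu hv).1 hq))

/-- For a minimal interval exchange transformation defined over
`ℤ[√d]` there is `C > 0` such that if the orbit segment
`{T^i z : -m+1 ≤ i ≤ n-1}` avoids the semi-interval `J = [u,v)` (with endpoints in
`ℤ[√d]`), then `|J| ≤ C / max (m,n)`. -/
theorem avoided_interval_small (d : ℤ) (hd : 2 ≤ d) (hsf : Squarefree d)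
    (s : ℕ) (l r : ℝ) (len : Fin s → ℝ) (π : Equiv.Perm (Fin s)) (T : Equiv.Perm ℝ)
    (hIET : IsIET s l r len π T) (hmin : IsMinimalOn T l r)
    (hdef : DefinedOverZ d s l r len π) :
    ∃ C : ℝ, 0 < C ∧ ∀ z ∈ Set.Ico l r, ∀ u v : ℝ, u < v →
      Set.Ico u v ⊆ Set.Ico l r → u ∈ Zsd d → v ∈ Zsd d →
      ∀ m n : ℕ, 1 ≤ m → 1 ≤ n →
      (∀ i : ℤ, -(m : ℤ) + 1 ≤ i → i ≤ (n : ℤ) - 1 → (T ^ i) z ∉ Set.Ico u v) →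
      v - u ≤ C / (max m n : ℕ) := by
  obtain ⟨hlr, hpos, hsum, hfix, htr⟩ := hIET
  obtain ⟨hlZ, hrZ, hZ⟩ := hdef
  have hd0 : 0 < d := by omega
  have hns := not_isSquare_of_squarefree hd hsf
  obtain ⟨M₁, hM₁, hα⟩ := exists_conjBound_of_mem_Zsd _ fun i => (hZ i).2
  obtain ⟨M₂, hM₂, hγ⟩ := exists_conjBound_of_mem_Zsd _ fun i => (hZ i).1
  obtain ⟨M₃, hM₃, hlr'⟩ := exists_conjBound_of_mem_Zsd (d := d) (fun b : Bool => if b then l else r)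
    (by intro b; cases b <;> simpa)
  obtain ⟨C₀, hC₀, happrox⟩ := exists_conjBound_mem_Ico hd0 hns (r - l) (by linarith)
  have hLpos : 0 < r - l := by linarith
  set D : ℝ := 2 * (2 * C₀ + (M₂ + M₃) * (r - l)) + 2 * M₁ with hD
  have hDpos : 0 < D := by positivity
  refine ⟨Real.exp (D * (r - l)), Real.exp_pos _, fun z hz u v huv hsub _ _ m n hm hn hav => ?_⟩
  have hε : 0 < v - u := by linarith
  obtain ⟨hlu, hvr⟩ := (Set.Ico_subset_Ico_iff huv).1 hsub
  obtain ⟨u₀, hu₀, hu₀c⟩ := happrox u ((v - u) / 2) (by linarith) (by linarith)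
  obtain ⟨v₀, hv₀, hv₀c⟩ := happrox (u + (v - u) / 2) ((v - u) / 2) (by linarith) (by linarith)
  have huv₀ : u₀ < v₀ := hu₀.2.trans_le hv₀.1
  have hJ : Set.Ico u₀ v₀ ⊆ Set.Ico u v :=
    Set.Ico_subset_Ico hu₀.1 (by linarith [hv₀.2])
  set B : ℝ := C₀ / ((v - u) / 2) + M₂ + M₃ with hB
  have hCpos : 0 < C₀ / ((v - u) / 2) := by positivity
  classical
  set E : Finset ℝ := {l, r, u₀, v₀} ∪ Finset.univ.image (sepPt l len) with hEdef
  have hγE : ∀ i, sepPt l len i ∈ E := fun i =>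
    Finset.mem_union_right _ (Finset.mem_image_of_mem _ (Finset.mem_univ i))
  have hrE : r ∈ E := by simp [hEdef]
  have hE : ∀ e ∈ E, ConjBound d B e := by
    intro e he
    simp only [hEdef, Finset.mem_union, Finset.mem_insert, Finset.mem_singleton,
      Finset.mem_image, Finset.mem_univ, true_and] at he
    rcases he with (rfl | rfl | rfl | rfl) | ⟨i, rfl⟩
    · exact (hlr' true).mono (by linarith)
    · exact (hlr' false).mono (by linarith)
    · exact hu₀c.mono (by linarith)
    · exact hv₀c.mono (by linarith)
    · exact (hγ i).mono (by linarith)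
  have hBK : 2 * B ≤ D * (1 / (v - u)) := by
    rw [mul_one_div, le_div_iff₀ hε, hB]
    have e : 2 * (C₀ / ((v - u) / 2) + M₂ + M₃) * (v - u)
        = 4 * C₀ + 2 * (M₂ + M₃) * (v - u) := by
      field_simp; ring
    rw [e, hD]
    nlinarith [mul_le_mul_of_nonneg_left (show v - u ≤ r - l by linarith) (by positivity : 0 ≤ M₂ + M₃)]
  have hmaps : ∀ x ∈ Set.Ico l r, T x ∈ Set.Ico l r :=
    fun x => perm_apply_mem_of_fixed_compl hfix
  set N : ℕ := m + n - 1 with hN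
  set z₀ := (T ^ (-(m : ℤ) + 1)) z with hz₀
  have hz₀mem : z₀ ∈ Set.Ico l r := by
    by_contra hn'
    have hfixp : ∀ k : ℕ, (T ^ k) z₀ = z₀ := fun k => by
      induction k with
      | zero => rfl
      | succ k ih => rw [pow_succ, Equiv.Perm.mul_apply, hfix _ hn', ih]
    have := hfixp (m - 1)
    rw [← zpow_natCast] at this
    nth_rewrite 1 [hz₀] at this
    rw [← Equiv.Perm.mul_apply, ← zpow_add, Nat.cast_sub hm] at this
    simp at this
    exact hn' (this ▸ hz)
  have hhit : ∃ p : ℤ, (T ^ p) z₀ ∈ Set.Ico u₀ v₀ := by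
    have hmid : (u₀ + v₀) / 2 ∈ Set.Ioo u₀ v₀ := ⟨by linarith, by linarith⟩
    have hcl := hmin z₀ hz₀mem (hsub (hJ (Set.Ioo_subset_Ico_self hmid)))
    obtain ⟨w, hw, p, rfl⟩ := mem_closure_iff.1 hcl _ isOpen_Ioo hmid
    exact ⟨p, Set.Ioo_subset_Ico_self hw⟩
  have key := card_avoiding_le hd0.le hns (M := M₁) (K := 1 / (v - u)) (D := D) (T := T) E
    (by simp [hEdef]) hrE (by simp [hEdef] : u₀ ∈ E) (by simp [hEdef] : v₀ ∈ E) hE hlr.le hfix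
    (fun x y hxy hx => by
      obtain ⟨i, hi⟩ := exists_mem_exchanged hlr hsum hx
      have hnext : sepPt l len i + len i ∈ E := by
        rcases sepPt_add_len hsum i with h | ⟨j, -, h⟩ <;> rw [h]
        exacts [hrE, hγE j]
      have hyi : y ∈ Set.Ico (sepPt l len i) (sepPt l len i + len i) :=
        ⟨(hxy _ (hγE i)).1 hi.1, not_le.1 fun h => not_le.2 hi.2 ((hxy _ hnext).2 h)⟩
      rw [htr i x hi, htr i y hyi]
      ring)
    (fun x hx => by
      obtain ⟨i, hi⟩ := exists_mem_exchanged hlr hsum hx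
      rw [htr i x hi, add_sub_cancel_left]
      exact hα i)
    hM₁.le (by positivity) hDpos hBK (by rw [hD]; nlinarith [mul_pos (add_pos hM₂ hM₃) hLpos])
    hz₀mem N
    (fun i hi h => by
      refine hav ((i : ℤ) + (-(m : ℤ) + 1)) (by omega) (by omega) (hJ ?_)
      rwa [zpow_add, Equiv.Perm.mul_apply, zpow_natCast])
    hhit
  rw [mul_one_div, le_div_iff₀ hε] at key
  have hmaxpos : (0 : ℝ) < (max m n : ℕ) := by
    exact_mod_cast lt_of_lt_of_le hm (le_max_left m n)
  have hmaxN : ((max m n : ℕ) : ℝ) ≤ N := by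
    exact_mod_cast (max_le (by omega) (by omega) : max m n ≤ N)
  rw [le_div_iff₀ hmaxpos]
  nlinarith

end
end

section
/- Let T be a regular interval exchange transformation on [ℓ,r) defined over ℤ[√d]. Then Π(J) = Θ(1) over admissible semi-intervals: there exist constants 0 < c₁ ≤ c₂ (depending only on T) such that every semi-interval J that is admissible for T has endpoints in ℤ[√d] ∪ {r} and satisfies c₁ ≤ Π(J) ≤ c₂; moreover one can take c₁ = 1/(4√d). -/
open Set MeasureTheory

noncomputable section

/-! ### Numbers of bounded height in `ℤ[√d]` -/

/-- `z = m + n√d` for some integers `m`, `n` of absolute value at most `B`. -/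
def HeightLE (d : ℤ) (B z : ℝ) : Prop :=
  ∃ m n : ℤ, z = (m : ℝ) + (n : ℝ) * Real.sqrt d ∧ |(m : ℝ)| ≤ B ∧ |(n : ℝ)| ≤ B

theorem HeightLE.mono {d : ℤ} {B C z : ℝ} (h : HeightLE d B z) (hBC : B ≤ C) :
    HeightLE d C z := by
  obtain ⟨m, n, hz, hm, hn⟩ := h
  exact ⟨m, n, hz, hm.trans hBC, hn.trans hBC⟩

theorem HeightLE.add {d : ℤ} {B C z w : ℝ} (hz : HeightLE d B z) (hw : HeightLE d C w) :
    HeightLE d (B + C) (z + w) := by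
  obtain ⟨m, n, rfl, hm, hn⟩ := hz
  obtain ⟨m', n', rfl, hm', hn'⟩ := hw
  refine ⟨m + m', n + n', by push_cast; ring, ?_, ?_⟩ <;> push_cast
  · exact (abs_add_le _ _).trans (add_le_add hm hm')
  · exact (abs_add_le _ _).trans (add_le_add hn hn')

theorem HeightLE.neg {d : ℤ} {B z : ℝ} (hz : HeightLE d B z) : HeightLE d B (-z) := by
  obtain ⟨m, n, rfl, hm, hn⟩ := hz
  exact ⟨-m, -n, by push_cast; ring, by simpa using hm, by simpa using hn⟩

theorem HeightLE.mem_Zsd {d : ℤ} {B z : ℝ} (hz : HeightLE d B z) : z ∈ Zsd d := by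
  obtain ⟨m, n, h, -⟩ := hz
  exact ⟨m, n, h⟩

theorem exists_heightLE {d : ℤ} {z : ℝ} (hz : z ∈ Zsd d) : ∃ B, HeightLE d B z := by
  obtain ⟨m, n, h⟩ := hz
  exact ⟨max |(m : ℝ)| |(n : ℝ)|, m, n, h, le_max_left _ _, le_max_right _ _⟩

theorem HeightLE.psiNum_le {d : ℤ} {B z : ℝ} (hz : HeightLE d B z) : (PsiNum d z : ℝ) ≤ B := by
  obtain ⟨m, n, h, hm, hn⟩ := hz
  have h1 : PsiNum d z ≤ max m.natAbs n.natAbs := Nat.sInf_le ⟨m, n, h, rfl⟩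
  calc (PsiNum d z : ℝ) ≤ ((max m.natAbs n.natAbs : ℕ) : ℝ) := by exact_mod_cast h1
    _ ≤ B := by
      rw [Nat.cast_max, Nat.cast_natAbs, Nat.cast_natAbs]
      push_cast
      exact max_le hm hn

theorem heightLE_psiNum {d : ℤ} {z : ℝ} (hz : z ∈ Zsd d) : HeightLE d (PsiNum d z) z := by
  obtain ⟨m, n, h⟩ := hz
  obtain ⟨m, n, h, hk⟩ := Nat.sInf_mem (s := {k : ℕ | ∃ m n : ℤ,
    z = (m : ℝ) + (n : ℝ) * Real.sqrt d ∧ k = max m.natAbs n.natAbs}) ⟨_, m, n, h, rfl⟩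
  have hk' : PsiNum d z = max m.natAbs n.natAbs := hk
  refine ⟨m, n, h, ?_, ?_⟩ <;> rw [hk', Nat.cast_max, Nat.cast_natAbs, Nat.cast_natAbs] <;>
    push_cast
  · exact le_max_left _ _
  · exact le_max_right _ _

theorem sq_ne_mul_sq_of_squarefree {d : ℤ} (hd : 2 ≤ d) (hsf : Squarefree d) {a b : ℤ}
    (hb : b ≠ 0) : a ^ 2 ≠ d * b ^ 2 := by
  intro h
  have hdvd : b ^ 2 ∣ a ^ 2 := ⟨d, by rw [h]; ring⟩
  obtain ⟨e, rfl⟩ := (Int.pow_dvd_pow_iff (by norm_num)).1 hdvd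
  have hde : d = e * e := by
    have : b ^ 2 * d = b ^ 2 * (e * e) := by linear_combination -h
    exact mul_left_cancel₀ (pow_ne_zero 2 hb) this
  have hu := hsf e ⟨1, by rw [hde]; ring⟩
  rcases Int.isUnit_iff.1 hu with rfl | rfl <;> norm_num at hde <;> omega

/-- Two distinct elements of `ℤ[√d]` of height at most `B` are at distance `≫ 1 / B`. -/
theorem HeightLE.one_le_sub_mul {d : ℤ} (hd : 2 ≤ d) (hsf : Squarefree d) {B z w : ℝ}
    (hz : HeightLE d B z) (hw : HeightLE d B w) (hzw : z < w) :
    1 ≤ (w - z) * (2 * B * (1 + Real.sqrt d)) := by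
  obtain ⟨m, n, h, hm, hn⟩ := hw.add hz.neg
  have hd0 : (0 : ℝ) ≤ d := by exact_mod_cast (by omega : (0 : ℤ) ≤ d)
  have hs := Real.sq_sqrt hd0
  have hs0 := Real.sqrt_nonneg (d : ℝ)
  set q := Real.sqrt d
  have hne : m ^ 2 - d * n ^ 2 ≠ 0 := by
    intro h0
    by_cases hn0 : n = 0
    · subst hn0
      have : m = 0 := by simpa using h0
      subst this
      simp at h
      linarith
    · exact sq_ne_mul_sq_of_squarefree hd hsf hn0 (sub_eq_zero.1 h0)
  have h1 : (1 : ℝ) ≤ |((m ^ 2 - d * n ^ 2 : ℤ) : ℝ)| := by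
    rw [← Int.cast_abs]
    exact_mod_cast Int.one_le_abs hne
  have h2 : ((m ^ 2 - d * n ^ 2 : ℤ) : ℝ) = (w - z) * (m - n * q) := by
    rw [sub_eq_add_neg w z, h]
    push_cast
    rw [← hs]
    ring
  have hpos : 0 < w - z := sub_pos.2 hzw
  rw [h2, abs_mul, abs_of_pos hpos] at h1
  refine h1.trans (mul_le_mul_of_nonneg_left ?_ hpos.le)
  calc |(m : ℝ) - n * q| ≤ |(m : ℝ)| + |n * q| := abs_sub _ _
    _ = |(m : ℝ)| + |(n : ℝ)| * q := by rw [abs_mul, abs_of_nonneg hs0]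
    _ ≤ (B + B) + (B + B) * q := by gcongr
    _ = 2 * B * (1 + q) := by ring

/-! ### Packing disjoint intervals -/

theorem sum_length_le_of_disjoint {l r : ℝ} (hlr : l ≤ r) {R : ℕ} {a b : ℕ → ℝ}
    (hab : ∀ k < R, l ≤ a k ∧ a k ≤ b k ∧ b k ≤ r)
    (hdisj : ∀ j k, j < k → k < R → Disjoint (Ico (a j) (b j)) (Ico (a k) (b k))) :
    ∑ k ∈ Finset.range R, (b k - a k) ≤ r - l := by
  have hd : (Finset.range R : Set ℕ).PairwiseDisjoint fun k => Ico (a k) (b k) := by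
    intro j hj k hk hjk
    simp only [Finset.coe_range, mem_Iio] at hj hk
    rcases lt_or_gt_of_ne hjk with h | h
    · exact hdisj j k h hk
    · exact (hdisj k j h hj).symm
  have h1 := measure_biUnion_finset (μ := volume) hd fun _ _ => measurableSet_Ico
  have h2 : volume (⋃ k ∈ Finset.range R, Ico (a k) (b k)) ≤ volume (Ico l r) := by
    refine measure_mono (iUnion₂_subset fun k hk => ?_)
    obtain ⟨ha, -, hb⟩ := hab k (Finset.mem_range.1 hk)
    exact Ico_subset_Ico ha hb
  rw [h1] at h2
  simp only [Real.volume_Ico] at h2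
  rw [← ENNReal.ofReal_sum_of_nonneg fun k hk =>
    sub_nonneg.2 (hab k (Finset.mem_range.1 hk)).2.1] at h2
  exact (ENNReal.ofReal_le_ofReal_iff (sub_nonneg.2 hlr)).1 h2

theorem log_sub_log_le_sum (n R : ℕ) :
    Real.log (n + 1 + R) - Real.log (n + 1) ≤ ∑ k ∈ Finset.range R, 1 / ((n : ℝ) + k + 1) := by
  induction R with
  | zero => simp
  | succ R ih =>
    rw [Finset.sum_range_succ]
    have hx : (0 : ℝ) < n + R + 1 := by positivity
    have h := Real.log_le_sub_one_of_pos (x := ((n : ℝ) + R + 1 + 1) / (n + R + 1)) (by positivity)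
    rw [Real.log_div (by positivity) hx.ne'] at h
    have e : ((n : ℝ) + R + 1 + 1) / (n + R + 1) - 1 = 1 / (n + R + 1) := by field_simp; ring
    rw [e] at h
    have e1 : (n : ℝ) + 1 + (R + 1 : ℕ) = n + R + 1 + 1 := by push_cast; ring
    have e2 : (n : ℝ) + 1 + R = n + R + 1 := by ring
    rw [e1]
    rw [e2] at ih
    linarith

theorem exists_lt_mul_of_sum_le {c : ℝ} (hc : 0 < c) (L : ℝ) :
    ∃ K : ℕ, 1 ≤ K ∧ ∀ n R : ℕ, 1 ≤ n →
      ∑ k ∈ Finset.range R, c / ((n : ℝ) + k + 1) ≤ L → R < K * n := by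
  refine ⟨⌈2 * Real.exp (L / c)⌉₊ + 1, by omega, fun n R hn h => ?_⟩
  have h1 := log_sub_log_le_sum n R
  have h2 : ∑ k ∈ Finset.range R, 1 / ((n : ℝ) + k + 1) ≤ L / c := by
    rw [le_div_iff₀ hc, Finset.sum_mul]
    refine le_trans (Finset.sum_le_sum fun k _ => ?_) h
    rw [one_div_mul_eq_div]
  have h3 : Real.log (n + 1 + R) ≤ Real.log (n + 1) + L / c := by linarith
  have h4 : (n : ℝ) + 1 + R ≤ (n + 1) * Real.exp (L / c) := by
    rw [Real.log_le_iff_le_exp (by positivity), Real.exp_add, Real.exp_log (by positivity)] at h3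
    exact h3
  have hn' : (1 : ℝ) ≤ n := by exact_mod_cast hn
  have h5 := Nat.le_ceil (2 * Real.exp (L / c))
  have h6 : (R : ℝ) < ((⌈2 * Real.exp (L / c)⌉₊ + 1) * n : ℕ) := by
    push_cast
    nlinarith [Real.exp_pos (L / c)]
  exact_mod_cast h6

/-- The points whose first visit to `J` along the sequence of maps `f` takes place at time `k`. -/
def firstHit (f : ℕ → ℝ → ℝ) (J : Set ℝ) (k : ℕ) : Set ℝ :=
  {y | f k y ∈ J ∧ ∀ i < k, f i y ∉ J}

theorem disjoint_firstHit (f : ℕ → ℝ → ℝ) (J : Set ℝ) {j k : ℕ} (hjk : j < k) :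
    Disjoint (firstHit f J j) (firstHit f J k) :=
  Set.disjoint_left.2 fun _ hj hk => hk.2 j hjk hj.1

/-- If each of the first `R` first-hit sets contains an interval of length `≫ 1 / (n + k + 1)`,
then `R = O(n)`, because the harmonic series diverges. -/
theorem exists_lt_mul_of_firstHit {l r c : ℝ} (hlr : l ≤ r) (hc : 0 < c) :
    ∃ K : ℕ, 1 ≤ K ∧ ∀ (n R : ℕ) (f : ℕ → ℝ → ℝ) (J : Set ℝ), 1 ≤ n →
      (∀ k < R, ∃ a b, l ≤ a ∧ b ≤ r ∧ c / ((n : ℝ) + k + 1) ≤ b - a ∧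
        Ico a b ⊆ firstHit f J k) → R < K * n := by
  obtain ⟨K, hK, hKR⟩ := exists_lt_mul_of_sum_le hc (r - l)
  refine ⟨K, hK, fun n R f J hn h => hKR n R hn ?_⟩
  choose! a b ha hb hab hsub using h
  refine (Finset.sum_le_sum fun k hk => hab k (Finset.mem_range.1 hk)).trans
    (sum_length_le_of_disjoint hlr (fun k hk => ⟨ha k hk, ?_, hb k hk⟩) fun j k hjk hk => ?_)
  · have : 0 ≤ c / ((n : ℝ) + k + 1) := by positivity
    linarith [hab k hk]
  · exact (disjoint_firstHit f J hjk).mono (hsub j (hjk.trans hk)) (hsub k hk)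

/-! ### Elementary properties of interval exchange transformations -/

section IET

variable {s : ℕ} {l r : ℝ} {len : Fin s → ℝ} {π : Equiv.Perm (Fin s)} {T : Equiv.Perm ℝ}

theorem sepPt_of_val_eq_zero {i : Fin s} (hi : (i : ℕ) = 0) : sepPt l len i = l := by
  have : Finset.univ.filter (fun j => j < i) = ∅ := by
    ext j
    simp [Fin.lt_def, hi]
  simp [sepPt, this]

theorem sepPt_add_len_of_succ {i j : Fin s} (hij : (j : ℕ) = i + 1) :
    sepPt l len j = sepPt l len i + len i := by
  have : Finset.univ.filter (fun k => k < j) = insert i (Finset.univ.filter (fun k => k < i)) := by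
    ext k
    simp only [Finset.mem_filter, Finset.mem_univ, true_and, Finset.mem_insert, Fin.lt_def,
      Fin.ext_iff]
    omega
  rw [sepPt, sepPt, this, Finset.sum_insert (by simp)]
  ring

theorem sepPt_add_len_of_last {i : Fin s} (hi : (i : ℕ) + 1 = s) :
    sepPt l len i + len i = l + ∑ j, len j := by
  have : (Finset.univ : Finset (Fin s)) = insert i (Finset.univ.filter (fun k => k < i)) := by
    ext k
    simp only [Finset.mem_filter, Finset.mem_univ, true_and, Finset.mem_insert, Fin.lt_def,
      Fin.ext_iff, true_iff]
    omega
  rw [sepPt, this, Finset.sum_insert (by simp), ← this]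
  ring

namespace IsIET

theorem sepPt_add_len (h : IsIET s l r len π T) (i : Fin s) :
    sepPt l len i + len i = r ∨
      ∃ j : Fin s, (j : ℕ) ≠ 0 ∧ sepPt l len j = sepPt l len i + len i := by
  by_cases hi : (i : ℕ) + 1 = s
  · left
    rw [sepPt_add_len_of_last hi, h.2.2.1]
    ring
  · exact Or.inr ⟨⟨i + 1, by omega⟩, by simp, sepPt_add_len_of_succ rfl⟩

theorem le_sepPt (h : IsIET s l r len π T) (i : Fin s) : l ≤ sepPt l len i :=
  le_add_of_nonneg_right (Finset.sum_nonneg fun j _ => (h.2.1 j).le)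

theorem sepPt_lt (h : IsIET s l r len π T) (i : Fin s) : sepPt l len i < r := by
  have h1 : ∑ j ∈ Finset.univ.filter (fun j => j < i), len j < ∑ j, len j :=
    Finset.sum_lt_sum_of_subset (Finset.filter_subset _ _) (Finset.mem_univ i) (by simp)
      (h.2.1 i) fun j _ _ => (h.2.1 j).le
  rw [h.2.2.1] at h1
  rw [sepPt]
  linarith

theorem sepPt_mem (h : IsIET s l r len π T) (i : Fin s) : sepPt l len i ∈ Ico l r :=
  ⟨h.le_sepPt i, h.sepPt_lt i⟩

theorem exists_mem (h : IsIET s l r len π T) {x : ℝ} (hx : x ∈ Ico l r) :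
    ∃ i, x ∈ Ico (sepPt l len i) (sepPt l len i + len i) := by
  have hs : 0 < s := by
    rcases Nat.eq_zero_or_pos s with rfl | hs
    · have h1 := h.2.2.1
      simp at h1
      linarith [h.1]
    · exact hs
  by_contra! hno
  have key : ∀ n (hn : n < s), sepPt l len ⟨n, hn⟩ + len ⟨n, hn⟩ ≤ x := by
    intro n
    induction n with
    | zero =>
      intro hn
      by_contra! hlt
      exact hno ⟨0, hn⟩ ⟨by rw [sepPt_of_val_eq_zero rfl]; exact hx.1, hlt⟩
    | succ n ih =>
      intro hn
      by_contra! hlt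
      refine hno ⟨n + 1, hn⟩ ⟨?_, hlt⟩
      rw [sepPt_add_len_of_succ (i := ⟨n, by omega⟩) rfl]
      exact ih _
  have h1 := key (s - 1) (by omega)
  rw [sepPt_add_len_of_last (by simp; omega), h.2.2.1] at h1
  linarith [hx.2]

theorem apply_mem_iff (h : IsIET s l r len π T) {x : ℝ} : T x ∈ Ico l r ↔ x ∈ Ico l r := by
  constructor
  · intro hx
    by_contra hn
    rw [h.2.2.2.1 x hn] at hx
    exact hn hx
  · intro hx
    by_contra hn
    have := T.injective (h.2.2.2.1 (T x) hn)
    rw [this] at hn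
    exact hn hx

theorem pow_apply_mem_iff (h : IsIET s l r len π T) (k : ℕ) {x : ℝ} :
    (T ^ k) x ∈ Ico l r ↔ x ∈ Ico l r := by
  induction k with
  | zero => simp
  | succ k ih => rw [pow_succ', Equiv.Perm.mul_apply, h.apply_mem_iff, ih]

theorem apply_eq (h : IsIET s l r len π T) {i : Fin s} {z : ℝ}
    (hz : z ∈ Ico (sepPt l len i) (sepPt l len i + len i)) :
    T z = z + (imgPt l len π i - sepPt l len i) :=
  h.2.2.2.2 i z hz

theorem sepPt_mem_Ico (h : IsIET s l r len π T) (i : Fin s) :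
    sepPt l len i ∈ Ico (sepPt l len i) (sepPt l len i + len i) :=
  ⟨le_rfl, by linarith [h.2.1 i]⟩

end IsIET

/-! ### Gaps between preimages of the separation points -/

/-- The points whose orbit reaches a separation point at some time `k < N`. -/
def preSep (l : ℝ) (len : Fin s → ℝ) (T : Equiv.Perm ℝ) (N : ℕ) : Set ℝ :=
  {w | ∃ i : Fin s, ∃ k < N, (T ^ k) w = sepPt l len i}

/-- `[a, b)` is a component of the partition of `[l, r)` by the points of `preSep l len T N`. -/
structure IsGap (l r : ℝ) (len : Fin s → ℝ) (T : Equiv.Perm ℝ) (N : ℕ) (a b : ℝ) : Prop where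
  left_mem : a ∈ preSep l len T N
  right_mem : b ∈ preSep l len T N ∨ b = r
  le_left : l ≤ a
  right_le : b ≤ r
  lt : a < b
  free : ∀ w ∈ Ioo a b, w ∉ preSep l len T N

theorem finite_preSep (N : ℕ) : (preSep l len T N).Finite := by
  have : preSep l len T N ⊆
      (fun p : Fin s × ℕ => (T ^ p.2).symm (sepPt l len p.1)) '' (univ ×ˢ Iio N) := by
    rintro w ⟨i, k, hk, hw⟩
    exact ⟨(i, k), ⟨mem_univ _, hk⟩, by simp [← hw]⟩
  exact ((finite_univ.prod (finite_Iio N)).image _).subset this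

namespace IsIET

theorem preSep_subset (h : IsIET s l r len π T) (N : ℕ) : preSep l len T N ⊆ Ico l r := by
  rintro w ⟨i, k, -, hw⟩
  rw [← h.pow_apply_mem_iff k, hw]
  exact h.sepPt_mem i

theorem exists_isGap (h : IsIET s l r len π T) (hs : 0 < s) {N : ℕ} (hN : 1 ≤ N) {x : ℝ}
    (hx : x ∈ Ico l r) : ∃ a b, IsGap l r len T N a b ∧ x ∈ Ico a b := by
  have hl : l ∈ preSep l len T N := ⟨⟨0, hs⟩, 0, hN, by simp [sepPt_of_val_eq_zero]⟩
  have hfin := finite_preSep (l := l) (len := len) (T := T) N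
  obtain ⟨a, ⟨ha, hax⟩, hamax⟩ := Set.exists_max_image (preSep l len T N ∩ Iic x) id
    (hfin.inter_of_left _) ⟨l, hl, hx.1⟩
  obtain ⟨b, ⟨hb, hxb⟩, hbmin⟩ := Set.exists_min_image ((preSep l len T N ∪ {r}) ∩ Ioi x) id
    ((hfin.union (finite_singleton r)).inter_of_left _) ⟨r, Or.inr rfl, hx.2⟩
  refine ⟨a, b, ⟨ha, hb, (h.preSep_subset N ha).1, ?_, lt_of_le_of_lt hax hxb, ?_⟩, hax, hxb⟩
  · rcases hb with hb | hb
    · exact (h.preSep_subset N hb).2.le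
    · exact le_of_eq hb
  · intro w hw hwD
    rcases le_or_gt w x with hwx | hwx
    · exact absurd (hamax w ⟨hwD, hwx⟩) (not_le.2 hw.1)
    · exact absurd (hbmin w ⟨Or.inl hwD, hwx⟩) (not_le.2 hw.2)

/-- `T ^ j` is a translation on an interval whose interior avoids `preSep l len T N`, `j ≤ N`. -/
theorem pow_sub_eq_of_free (h : IsIET s l r len π T) {N : ℕ} {a b : ℝ} (hla : l ≤ a) (hbr : b ≤ r)
    (hfree : ∀ w ∈ Ioo a b, w ∉ preSep l len T N) {j : ℕ} (hj : j ≤ N) {x : ℝ}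
    (hx : x ∈ Ico a b) : (T ^ j) x = x + ((T ^ j) a - a) := by
  induction j generalizing x with
  | zero => simp
  | succ j ih =>
    have ih' := fun {x} => ih (x := x) (by omega)
    set t := (T ^ j) a - a
    have ha : (T ^ j) a ∈ Ico l r :=
      (h.pow_apply_mem_iff j).2 ⟨hla, (hx.1.trans_lt hx.2).trans_le hbr⟩
    have hxm : (T ^ j) x ∈ Ico l r :=
      (h.pow_apply_mem_iff j).2 ⟨hla.trans hx.1, hx.2.trans_le hbr⟩
    obtain ⟨i, hi⟩ := h.exists_mem ha
    have hxi : (T ^ j) x ∈ Ico (sepPt l len i) (sepPt l len i + len i) := by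
      have hxt := ih' hx
      have hat : (T ^ j) a = a + t := by simp [t]
      refine ⟨hi.1.trans (by rw [hxt, hat]; linarith [hx.1]), ?_⟩
      by_contra! hge
      rcases h.sepPt_add_len i with he | ⟨i', -, he⟩
      · linarith [hxm.2]
      · rw [← he] at hge hi
        have hz : sepPt l len i' - t ∈ Ioo a b := by
          constructor
          · linarith [hi.2]
          · linarith [hx.2]
        refine hfree _ hz ⟨i', j, by omega, ?_⟩
        rw [ih' ⟨hz.1.le, hz.2⟩]
        ring
    rw [pow_succ', Equiv.Perm.mul_apply, Equiv.Perm.mul_apply, h.apply_eq hi, h.apply_eq hxi,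
      ih' hx]
    simp only [t]
    ring

/-- Points of an interval that avoids `preSep l len T (n + k)` visit a union of gaps of order `n`
at the same times `i ≤ k`. -/
theorem pow_mem_of_free (h : IsIET s l r len π T) {n k : ℕ} {a b p q : ℝ} (hla : l ≤ a)
    (hbr : b ≤ r) (hfree : ∀ w ∈ Ioo a b, w ∉ preSep l len T (n + k))
    (hp : p ∈ preSep l len T n ∨ p = r) (hq : q ∈ preSep l len T n ∨ q = r)
    {i : ℕ} (hi : i ≤ k) {x y : ℝ} (hx : x ∈ Ico a b) (hy : y ∈ Ico a b)
    (hxJ : (T ^ i) x ∈ Ico p q) : (T ^ i) y ∈ Ico p q := by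
  have htr := fun {z} (hz : z ∈ Ico a b) =>
    h.pow_sub_eq_of_free hla hbr hfree (hi.trans (Nat.le_add_left k n)) hz
  set t := (T ^ i) a - a
  have key : ∀ e, (e ∈ preSep l len T n ∨ e = r) → ∀ z ∈ Ioo a b, (T ^ i) z ≠ e := by
    rintro e he z hz rfl
    rcases he with ⟨i', j, hj, he⟩ | he
    · refine hfree z hz ⟨i', j + i, by omega, ?_⟩
      rw [pow_add, Equiv.Perm.mul_apply, he]
    · have : (T ^ i) z ∈ Ico l r :=
        (h.pow_apply_mem_iff i).2 ⟨hla.trans hz.1.le, hz.2.trans_le hbr⟩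
      exact this.2.ne he
  rw [htr hx] at hxJ
  rw [htr hy]
  constructor
  · by_contra! hlt
    have hz : p - t ∈ Ioo a b := ⟨by linarith [hy.1], by linarith [hx.2, hxJ.1]⟩
    exact key p hp _ hz (by rw [htr ⟨hz.1.le, hz.2⟩]; ring)
  · by_contra! hle
    have hz : q - t ∈ Ioo a b := ⟨by linarith [hx.1, hxJ.2], by linarith [hy.2]⟩
    exact key q hq _ hz (by rw [htr ⟨hz.1.le, hz.2⟩]; ring)

theorem pow_add_sub_le (h : IsIET s l r len π T) {N : ℕ} {a b : ℝ} (hla : l ≤ a) (hbr : b ≤ r)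
    (hab : a < b) (hfree : ∀ w ∈ Ioo a b, w ∉ preSep l len T N) {j : ℕ} (hj : j ≤ N) :
    (T ^ j) a + (b - a) ≤ r := by
  by_contra! hlt
  have ha : (T ^ j) a ∈ Ico l r := (h.pow_apply_mem_iff j).2 ⟨hla, hab.trans_le hbr⟩
  have hz : r - ((T ^ j) a - a) ∈ Ico a b := ⟨by linarith [ha.2], by linarith⟩
  have h1 := h.pow_sub_eq_of_free hla hbr hfree hj hz
  have h2 : (T ^ j) (r - ((T ^ j) a - a)) ∈ Ico l r :=
    (h.pow_apply_mem_iff j).2 ⟨hla.trans hz.1, hz.2.trans_le hbr⟩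
  linarith [h2.2]

end IsIET

end IET

/-! ### Keane's argument -/

section Keane

variable {s : ℕ} {l r : ℝ} {len : Fin s → ℝ} {π : Equiv.Perm (Fin s)} {T : Equiv.Perm ℝ}

theorem finite_orbitZ {m : ℕ} (hm : 0 < m) {x : ℝ} (hx : (T ^ m) x = x) : (orbitZ T x).Finite := by
  refine ((finite_Ico (0 : ℤ) m).image fun k : ℤ => (T ^ k) x).subset ?_
  rintro w ⟨n, rfl⟩
  have hm' : (0 : ℤ) < m := by exact_mod_cast hm
  refine ⟨n % m, ⟨Int.emod_nonneg _ hm'.ne', Int.emod_lt_of_pos _ hm'⟩, ?_⟩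
  have hx' : ((T ^ m) ^ (n / (m : ℤ))) x = x :=
    Equiv.Perm.zpow_apply_eq_self_of_apply_eq_self hx _
  conv_rhs => rw [← Int.emod_add_mul_ediv n m]
  rw [zpow_add, zpow_mul, zpow_natCast, Equiv.Perm.mul_apply, hx']

theorem IsRegularIET.pow_sepPt_ne (hreg : IsRegularIET s l len T) {i j : Fin s}
    (hi : (i : ℕ) ≠ 0) (hj : (j : ℕ) ≠ 0) {m : ℕ} (hm : 0 < m) :
    (T ^ m) (sepPt l len i) ≠ sepPt l len j := by
  intro h
  by_cases hij : i = j
  · subst hij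
    exact hreg.1 i hi (finite_orbitZ hm h)
  · exact Set.disjoint_left.1 (hreg.2 i j hi hj hij) ⟨m, by simpa using h⟩ ⟨0, by simp⟩

namespace IsIET

theorem exists_apply_sepPt_le (h : IsIET s l r len π T) {y : ℝ} (hy : y ∈ Ico l r) :
    ∃ j, T.symm y ∈ Ico (sepPt l len j) (sepPt l len j + len j) ∧ T (sepPt l len j) ≤ y := by
  have hz : T.symm y ∈ Ico l r := by rw [← h.apply_mem_iff]; simpa using hy
  obtain ⟨j, hj⟩ := h.exists_mem hz
  have h1 := h.apply_eq hj
  have h2 := h.apply_eq (h.sepPt_mem_Ico j)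
  rw [Equiv.apply_symm_apply] at h1
  exact ⟨j, hj, by linarith [hj.1]⟩

theorem add_len_le_sepPt (h : IsIET s l r len π T) {i j : Fin s} (hij : i < j) :
    sepPt l len i + len i ≤ sepPt l len j := by
  have : insert i (Finset.univ.filter fun k => k < i) ⊆ Finset.univ.filter fun k => k < j := by
    intro k
    simp only [Finset.mem_insert, Finset.mem_filter, Finset.mem_univ, true_and]
    rintro (rfl | hk)
    · exact hij
    · exact hk.trans hij
  have h1 := Finset.sum_le_sum_of_subset_of_nonneg this (f := len) fun k _ _ => (h.2.1 k).le
  rw [Finset.sum_insert (by simp)] at h1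
  rw [sepPt, sepPt]
  linarith

theorem exists_apply_sepPt_eq_left (h : IsIET s l r len π T) (hreg : IsRegularIET s l len T)
    (hs : 2 ≤ s) : ∃ q : Fin s, (q : ℕ) ≠ 0 ∧ T (sepPt l len q) = l := by
  have hl : l ∈ Ico l r := ⟨le_rfl, h.1⟩
  obtain ⟨j, -, hj⟩ := h.exists_apply_sepPt_le hl
  replace hj : T (sepPt l len j) = l := le_antisymm hj (h.apply_mem_iff.2 (h.sepPt_mem j)).1
  by_cases hj0 : (j : ℕ) = 0
  swap
  · exact ⟨j, hj0, hj⟩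
  exfalso
  have hfix : ∀ z ∈ Ico (sepPt l len j) (sepPt l len j + len j), T z = z := by
    intro z hz
    have h1 := h.apply_eq (h.sepPt_mem_Ico j)
    rw [hj, sepPt_of_val_eq_zero hj0] at h1
    rw [h.apply_eq hz, sepPt_of_val_eq_zero hj0]
    linarith
  have hnext : sepPt l len ⟨1, hs⟩ = sepPt l len j + len j := sepPt_add_len_of_succ (by simp [hj0])
  obtain ⟨k, hkm, hk'⟩ := h.exists_apply_sepPt_le (h.sepPt_mem ⟨1, hs⟩)
  have hk0 : (k : ℕ) ≠ 0 := by
    intro hk0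
    obtain rfl : k = j := Fin.ext (hk0.trans hj0.symm)
    have := hfix _ hkm
    rw [Equiv.apply_symm_apply] at this
    rw [← this, hnext] at hkm
    exact hkm.2.ne rfl
  rcases hk'.eq_or_lt with hk' | hk'
  · exact hreg.pow_sepPt_ne hk0 (j := ⟨1, hs⟩) (by simp) one_pos (by simpa using hk')
  · have hmem : T (sepPt l len k) ∈ Ico (sepPt l len j) (sepPt l len j + len j) := by
      refine ⟨?_, hnext ▸ hk'⟩
      rw [sepPt_of_val_eq_zero hj0]
      exact (h.apply_mem_iff.2 (h.sepPt_mem k)).1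
    have heq := T.injective (hfix _ hmem)
    rw [heq] at hmem
    have hjk : j < k := by rw [Fin.lt_def]; omega
    exact absurd hmem.2 (not_lt.2 (h.add_len_le_sepPt hjk))

end IsIET

/-- Membership in `E` is constant on a left neighbourhood of `p`, including `p`. -/
def LeftConst (E : Set ℝ) (p : ℝ) : Prop :=
  ∃ ε > 0, ∀ y ∈ Ioo (p - ε) p, (y ∈ E ↔ p ∈ E)

namespace IsIET

theorem leftConst_apply_iff (h : IsIET s l r len π T) {E : Set ℝ}
    (hE : ∀ x ∈ Ico l r, (T x ∈ E ↔ x ∈ E)) {p : ℝ} (hp : p ∈ Ioo l r)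
    (hsep : ∀ i, p ≠ sepPt l len i) :
    T p ∈ Ioo l r ∧ (LeftConst E (T p) ↔ LeftConst E p) := by
  obtain ⟨i, hi⟩ := h.exists_mem (Ioo_subset_Ico_self hp)
  have hip : sepPt l len i < p := lt_of_le_of_ne hi.1 (hsep i).symm
  set α := imgPt l len π i - sepPt l len i
  have hT : ∀ y ∈ Ioc (sepPt l len i) p, T y = y + α ∧ (T y ∈ E ↔ y ∈ E) := fun y hy =>
    ⟨h.apply_eq ⟨hy.1.le, hy.2.trans_lt hi.2⟩,
      hE y ⟨(h.le_sepPt i).trans hy.1.le, hy.2.trans_lt hp.2⟩⟩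
  obtain ⟨hTp, hEp⟩ := hT p ⟨hip, le_rfl⟩
  refine ⟨⟨?_, (h.apply_mem_iff.2 (Ioo_subset_Ico_self hp)).2⟩, ?_, ?_⟩
  · have h1 := (h.apply_mem_iff.2 (h.sepPt_mem i)).1
    rw [h.apply_eq (h.sepPt_mem_Ico i)] at h1
    rw [hTp]
    linarith
  · rintro ⟨ε, hε, hc⟩
    refine ⟨min ε (p - sepPt l len i), lt_min hε (sub_pos.2 hip), fun y hy => ?_⟩
    have h1 := min_le_left ε (p - sepPt l len i)
    have h2 := min_le_right ε (p - sepPt l len i)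
    obtain ⟨hTy, hEy⟩ := hT y ⟨by linarith [hy.1], hy.2.le⟩
    rw [← hEy, ← hEp]
    exact hc _ ⟨by rw [hTy, hTp]; linarith [hy.1], by rw [hTy, hTp]; linarith [hy.2]⟩
  · rintro ⟨ε, hε, hc⟩
    refine ⟨min ε (p - sepPt l len i), lt_min hε (sub_pos.2 hip), fun y hy => ?_⟩
    rw [hTp] at hy
    have h1 := min_le_left ε (p - sepPt l len i)
    have h2 := min_le_right ε (p - sepPt l len i)
    obtain ⟨hTy, hEy⟩ := hT (y - α) ⟨by linarith [hy.1], by linarith [hy.2]⟩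
    rw [sub_add_cancel] at hTy
    rw [hTy] at hEy
    rw [hEp, hEy]
    exact hc _ ⟨by linarith [hy.1], by linarith [hy.2]⟩

theorem exists_not_leftConst_sepPt (h : IsIET s l r len π T) {E : Set ℝ}
    (hE : ∀ x ∈ Ico l r, (T x ∈ E ↔ x ∈ E)) {p : ℝ} (hp : p ∈ Ioo l r) (hpE : ¬ LeftConst E p)
    {k : ℕ} {i : Fin s} (hk : (T ^ k) p = sepPt l len i) :
    ∃ j : Fin s, (j : ℕ) ≠ 0 ∧ ¬ LeftConst E (sepPt l len j) := by
  induction k generalizing p with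
  | zero =>
    have hpi : p = sepPt l len i := by simpa using hk
    subst hpi
    exact ⟨i, fun h0 => hp.1.ne' (sepPt_of_val_eq_zero h0), hpE⟩
  | succ k ih =>
    by_cases hsep : ∀ j, p ≠ sepPt l len j
    · obtain ⟨h1, h2⟩ := h.leftConst_apply_iff hE hp hsep
      exact ih h1 (h2.not.2 hpE) (by rw [← hk, pow_succ, Equiv.Perm.mul_apply])
    · push Not at hsep
      obtain ⟨j, rfl⟩ := hsep
      exact ⟨j, fun h0 => hp.1.ne' (sepPt_of_val_eq_zero h0), hpE⟩

/-- A `T`-invariant union of gaps is trivial. -/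
theorem mem_of_invariant (h : IsIET s l r len π T) (hreg : IsRegularIET s l len T) (hs : 2 ≤ s)
    {E : Set ℝ} (hE : ∀ x ∈ Ico l r, (T x ∈ E ↔ x ∈ E)) {N : ℕ} (hN : 1 ≤ N)
    (hgap : ∀ a b, IsGap l r len T N a b → ∀ x ∈ Ico a b, ∀ y ∈ Ico a b, x ∈ E → y ∈ E)
    {x y : ℝ} (hx : x ∈ Ico l r) (hy : y ∈ Ico l r) (hxE : x ∈ E) : y ∈ E := by
  have hjump : ∀ p ∈ Ioo l r, ¬ LeftConst E p → p ∈ preSep l len T N := by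
    intro p hp hpE
    by_contra hpD
    obtain ⟨a, b, hG, hpG⟩ := h.exists_isGap (by omega) hN (Ioo_subset_Ico_self hp)
    have hap : a < p := lt_of_le_of_ne hpG.1 fun e => hpD (e ▸ hG.left_mem)
    refine hpE ⟨p - a, sub_pos.2 hap, fun y hy => ?_⟩
    have hyG : y ∈ Ico a b := ⟨by linarith [hy.1], hy.2.trans hpG.2⟩
    exact ⟨hgap a b hG y hyG p hpG, hgap a b hG p hpG y hyG⟩
  have hnojump : ∀ p ∈ Ioo l r, LeftConst E p := by
    intro p hp
    by_contra hpE
    obtain ⟨i, k, -, hk⟩ := hjump p hp hpE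
    obtain ⟨j, hj, hjE⟩ := h.exists_not_leftConst_sepPt hE hp hpE hk
    obtain ⟨q, hq, hql⟩ := h.exists_apply_sepPt_eq_left hreg hs
    have hback : ∀ m : ℕ, (T ^ m).symm (sepPt l len j) ∈ Ioo l r ∧
        ¬ LeftConst E ((T ^ m).symm (sepPt l len j)) := by
      intro m
      induction m with
      | zero =>
        refine ⟨⟨lt_of_le_of_ne (h.le_sepPt j) fun e => ?_, h.sepPt_lt j⟩, hjE⟩
        exact hreg.pow_sepPt_ne hq hj one_pos (by rw [pow_one, hql]; exact e)
      | succ m ih =>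
        set p' := (T ^ (m + 1)).symm (sepPt l len j) with hp'
        have hpow : (T ^ (m + 1)) p' = sepPt l len j := by simp [hp']
        have hTp' : T p' = (T ^ m).symm (sepPt l len j) := by
          rw [Equiv.eq_symm_apply, ← hpow, pow_succ, Equiv.Perm.mul_apply]
        have hmem : p' ∈ Ico l r := by
          rw [← h.pow_apply_mem_iff (m + 1), hpow]
          exact h.sepPt_mem j
        have hnl : p' ≠ l := by
          intro e
          refine hreg.pow_sepPt_ne hq hj (Nat.succ_pos (m + 1)) ?_
          rw [Nat.succ_eq_add_one, pow_succ, Equiv.Perm.mul_apply, hql]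
          exact e ▸ hpow
        have hsep : ∀ i, p' ≠ sepPt l len i := by
          intro i e
          by_cases hi : (i : ℕ) = 0
          · exact hnl (e.trans (sepPt_of_val_eq_zero hi))
          · exact hreg.pow_sepPt_ne hi hj (Nat.succ_pos m) (e ▸ hpow)
        have hIoo : p' ∈ Ioo l r := ⟨lt_of_le_of_ne hmem.1 hnl.symm, hmem.2⟩
        refine ⟨hIoo, (h.leftConst_apply_iff hE hIoo hsep).2.not.1 ?_⟩
        rw [hTp']
        exact ih.2
    refine Set.infinite_of_injective_forall_mem (f := fun m : ℕ => (T ^ m).symm (sepPt l len j))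
      (Function.Injective.of_lt_imp_ne fun m n hmn e => ?_)
      (fun m => hjump _ (hback m).1 (hback m).2) (finite_preSep N)
    have e' : (T ^ m).symm (sepPt l len j) = (T ^ n).symm (sepPt l len j) := e
    rw [Equiv.eq_symm_apply] at e'
    refine hreg.pow_sepPt_ne hj hj (Nat.sub_pos_of_lt hmn) ?_
    conv_rhs => rw [← e']
    conv_rhs => rw [← Nat.sub_add_cancel hmn.le, pow_add, Equiv.Perm.mul_apply]
    simp
  classical
  have hcont : ContinuousOn (fun z => decide (z ∈ E)) (Ico l r) := by
    intro p hp
    obtain ⟨a, b, hG, hpG⟩ := h.exists_isGap (by omega) hN hp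
    have hnear : ∃ a' < p, ∀ y ∈ Ico l r, a' < y → y < p → (y ∈ E ↔ p ∈ E) := by
      rcases hp.1.eq_or_lt with e | hlt
      · exact ⟨p - 1, by linarith, fun y hy _ hyp => absurd hy.1 (not_le.2 (e ▸ hyp))⟩
      · obtain ⟨ε, hε, hc⟩ := hnojump p ⟨hlt, hp.2⟩
        exact ⟨p - ε, by linarith, fun y _ hy hyp => hc y ⟨hy, hyp⟩⟩
    obtain ⟨a', ha', hleft⟩ := hnear
    refine (continuousWithinAt_const (b := decide (p ∈ E))).congr_of_eventuallyEq ?_ rfl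
    filter_upwards [self_mem_nhdsWithin,
      mem_nhdsWithin_of_mem_nhds (Ioo_mem_nhds ha' hpG.2)] with y hy hy'
    simp only [decide_eq_decide]
    rcases lt_or_ge y p with hyp | hyp
    · exact hleft y hy hy'.1 hyp
    · have hyG : y ∈ Ico a b := ⟨hpG.1.trans hyp, hy'.2⟩
      exact ⟨hgap a b hG y hyG p hpG, hgap a b hG p hpG y hyG⟩
  have := isPreconnected_Ico.constant hcont hx hy
  simpa [hxE] using this

/-! ### Linear recurrence -/

theorem exists_pow_mem_of_isGap (h : IsIET s l r len π T) (hreg : IsRegularIET s l len T)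
    (hs : 2 ≤ s) {c : ℝ} (hc : 0 < c)
    (hlow : ∀ N a b, 1 ≤ N → IsGap l r len T N a b → c / (N : ℝ) ≤ b - a) :
    ∃ K : ℕ, 1 ≤ K ∧ ∀ n a b, 1 ≤ n → IsGap l r len T n a b → ∀ x ∈ Ico l r,
      ∃ k < K * n, (T ^ k) x ∈ Ico a b := by
  obtain ⟨K, hK, hKR⟩ := exists_lt_mul_of_firstHit h.1.le hc
  refine ⟨K, hK, fun n a b hn hJ => ?_⟩
  have hgapAt : ∀ (k : ℕ), ∀ x ∈ Ico l r, ∃ p q, IsGap l r len T (n + (k + 1)) p q ∧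
      c / ((n : ℝ) + k + 1) ≤ q - p ∧ x ∈ Ico p q ∧
      ∀ y ∈ Ico p q, ∀ i ≤ k, ((T ^ i) y ∈ Ico a b ↔ (T ^ i) x ∈ Ico a b) := by
    intro k x hx
    obtain ⟨p, q, hG, hxG⟩ := h.exists_isGap (by omega) (by omega : 1 ≤ n + (k + 1)) hx
    refine ⟨p, q, hG, ?_, hxG, fun y hy i hi => ?_⟩
    · have := hlow _ _ _ (by omega) hG
      push_cast at this
      rwa [← add_assoc] at this
    · have hpm := fun {x y} (hx : x ∈ Ico p q) (hy : y ∈ Ico p q) =>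
        h.pow_mem_of_free hG.le_left hG.right_le hG.free (Or.inl hJ.left_mem) hJ.right_mem
          (hi.trans (Nat.le_succ k)) hx hy
      exact ⟨hpm hy hxG, hpm hxG hy⟩
  have hentry : ∀ k, ∀ x ∈ Ico l r, (T ^ k) x ∈ Ico a b → (∀ i < k, (T ^ i) x ∉ Ico a b) →
      k < K * n := by
    intro R x hx hxR hxi
    refine hKR n R (fun k => ⇑(T ^ k)) (Ico a b) hn fun k hk => ?_
    obtain ⟨p, q, hG, hlen, -, hiff⟩ :=
      hgapAt k ((T ^ (R - k)) x) ((h.pow_apply_mem_iff _).2 hx)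
    refine ⟨p, q, hG.le_left, hG.right_le, hlen, fun y hy => ⟨?_, fun i hi => ?_⟩⟩
    · rw [hiff y hy k le_rfl, ← Equiv.Perm.mul_apply, ← pow_add, Nat.add_sub_cancel' hk.le]
      exact hxR
    · rw [hiff y hy i hi.le, ← Equiv.Perm.mul_apply, ← pow_add]
      exact hxi _ (by omega)
  have hreturn : ∀ R, ∀ x ∈ Ico a b, (∀ i, 0 < i → i ≤ R → (T ^ i) x ∉ Ico a b) →
      R < K * n := by
    intro R x hxJ hxi
    have hx : x ∈ Ico l r := ⟨hJ.le_left.trans hxJ.1, hxJ.2.trans_le hJ.right_le⟩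
    refine hKR n R (fun k => ⇑(T ^ k).symm) (Ico a b) hn fun k hk => ?_
    obtain ⟨p, q, hG, hlen, -, hiff⟩ := hgapAt k x hx
    have hp : (T ^ k) p ∈ Ico l r :=
      (h.pow_apply_mem_iff k).2 ⟨hG.le_left, hG.lt.trans_le hG.right_le⟩
    refine ⟨(T ^ k) p, (T ^ k) p + (q - p), hp.1,
      h.pow_add_sub_le hG.le_left hG.right_le hG.lt hG.free (by omega), by linarith, ?_⟩
    intro y hy
    have hz : y - ((T ^ k) p - p) ∈ Ico p q := ⟨by linarith [hy.1], by linarith [hy.2]⟩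
    have hzy := h.pow_sub_eq_of_free hG.le_left hG.right_le hG.free (by omega : k ≤ _) hz
    rw [sub_add_cancel] at hzy
    set z := y - ((T ^ k) p - p)
    rw [← hzy]
    have hback : ∀ i ≤ k, (T ^ i).symm ((T ^ k) z) = (T ^ (k - i)) z := by
      intro i hi
      rw [Equiv.symm_apply_eq, ← Equiv.Perm.mul_apply, ← pow_add, Nat.add_sub_cancel' hi]
    refine ⟨?_, fun i hi => ?_⟩
    · have := (hiff z hz 0 (Nat.zero_le k)).2 (by simpa using hxJ)
      simpa using this
    · beta_reduce
      rw [hback i hi.le, hiff z hz _ (Nat.sub_le k i)]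
      exact hxi _ (by omega) (by omega)
  have hfirst : ∀ x ∈ Ico l r, (∃ k, (T ^ k) x ∈ Ico a b) → ∃ k < K * n, (T ^ k) x ∈ Ico a b := by
    classical
    intro x hx hex
    exact ⟨Nat.find hex, hentry _ x hx (Nat.find_spec hex) fun i hi => Nat.find_min hex hi,
      Nat.find_spec hex⟩
  intro x hx
  refine hfirst x hx ?_
  by_contra! hxE
  have haJ : a ∈ Ico a b := ⟨le_rfl, hJ.lt⟩
  have haI : a ∈ Ico l r := ⟨hJ.le_left, hJ.lt.trans_le hJ.right_le⟩
  refine h.mem_of_invariant hreg hs (E := {z | ∀ k : ℕ, (T ^ k) z ∉ Ico a b}) (N := n + K * n)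
    (fun z hz => ⟨fun hTz k => ?_, fun hz k => ?_⟩) (by omega)
    (fun p q hG y hy z hz hyE => ?_) hx haI hxE 0 (by simpa using haJ)
  · have hTz' : ∀ i, 0 < i → (T ^ i) z ∉ Ico a b := by
      intro i hi
      obtain ⟨j, rfl⟩ := Nat.exists_eq_add_of_lt hi
      rw [pow_succ, Equiv.Perm.mul_apply]
      exact hTz _
    rcases Nat.eq_zero_or_pos k with rfl | hk
    · intro hzJ
      exact lt_irrefl _ (hreturn (K * n) z (by simpa using hzJ) fun i hi _ => hTz' i hi)
    · exact hTz' k hk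
  · rw [← Equiv.Perm.mul_apply, ← pow_succ]
    exact hz _
  · intro k hk
    obtain ⟨k, hkn, hk⟩ := hfirst z ⟨hG.le_left.trans hz.1, hz.2.trans_le hG.right_le⟩ ⟨k, hk⟩
    exact hyE k (h.pow_mem_of_free hG.le_left hG.right_le hG.free (Or.inl hJ.left_mem)
      hJ.right_mem hkn.le hz hy hk)

/-- No positive power of a regular interval exchange transformation is a translation. -/
theorem not_forall_pow_eq_add (h : IsIET s l r len π T) (hreg : IsRegularIET s l len T)
    (hs : 2 ≤ s) {m : ℕ} (hm : 0 < m) (t : ℝ) : ¬ ∀ y ∈ Ico l r, (T ^ m) y = y + t := by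
  intro hT
  have ht0 : 0 ≤ t := by
    have h1 := hT l ⟨le_rfl, h.1⟩
    have h2 := ((h.pow_apply_mem_iff m).2 (⟨le_rfl, h.1⟩ : l ∈ Ico l r)).1
    linarith
  have ht : t = 0 := by
    by_contra hne
    have hpos : 0 < t := lt_of_le_of_ne ht0 (Ne.symm hne)
    have hy : max l (r - t) ∈ Ico l r := ⟨le_max_left _ _, max_lt h.1 (by linarith)⟩
    have h1 := hT _ hy
    have h2 := ((h.pow_apply_mem_iff m).2 hy).2
    linarith [le_max_right l (r - t)]
  refine hreg.pow_sepPt_ne (i := ⟨1, hs⟩) (j := ⟨1, hs⟩) (by simp) (by simp) hm ?_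
  rw [hT _ (h.sepPt_mem _), ht, add_zero]

theorem mul_gap_le (h : IsIET s l r len π T) (hreg : IsRegularIET s l len T) (hs : 2 ≤ s) {K : ℕ}
    (hhit : ∀ n a b, 1 ≤ n → IsGap l r len T n a b → ∀ x ∈ Ico l r,
      ∃ k < K * n, (T ^ k) x ∈ Ico a b) (hK : 1 ≤ K) {q : ℕ} {a b : ℝ}
    (hG : IsGap l r len T (K * q) a b) : q * (b - a) ≤ r - l := by
  have hle : ∀ k < q, k ≤ K * q := fun k hk => hk.le.trans (Nat.le_mul_of_pos_left q hK)
  have htr := fun {j} (hj : j ≤ K * q) {x} (hx : x ∈ Ico a b) =>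
    h.pow_sub_eq_of_free hG.le_left hG.right_le hG.free hj hx
  have haI : a ∈ Ico l r := ⟨hG.le_left, hG.lt.trans_le hG.right_le⟩
  have key := sum_length_le_of_disjoint h.1.le (R := q) (a := fun k => (T ^ k) a)
    (b := fun k => (T ^ k) a + (b - a))
    (fun k hk => ⟨((h.pow_apply_mem_iff k).2 haI).1, by linarith [hG.lt],
      h.pow_add_sub_le hG.le_left hG.right_le hG.lt hG.free (hle k hk)⟩) ?_
  · simpa only [add_sub_cancel_left, Finset.sum_const, Finset.card_range, nsmul_eq_mul] using key
  intro j k hjk hk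
  refine Set.disjoint_left.2 fun w hwj hwk => ?_
  have hpre : ∀ i < q, w ∈ Ico ((T ^ i) a) ((T ^ i) a + (b - a)) →
      ∃ z ∈ Ico a b, (T ^ i) z = w := by
    intro i hi hw
    have hz : w - ((T ^ i) a - a) ∈ Ico a b := ⟨by linarith [hw.1], by linarith [hw.2]⟩
    exact ⟨_, hz, by rw [htr (hle i hi) hz]; ring⟩
  obtain ⟨z, hz, hzw⟩ := hpre j (hjk.trans hk) hwj
  obtain ⟨z', hz', hzw'⟩ := hpre k hk hwk
  have hret : (T ^ (k - j)) z' = z := by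
    apply (T ^ j).injective
    rw [← Equiv.Perm.mul_apply, ← pow_add, Nat.add_sub_cancel' hjk.le, hzw, hzw']
  have hm : 0 < k - j := Nat.sub_pos_of_lt hjk
  refine h.not_forall_pow_eq_add hreg hs hm (z - z') fun y hy => ?_
  obtain ⟨p, p', hGy, hyG⟩ := h.exists_isGap (by omega) hm hy
  obtain ⟨i, hi, hiG⟩ := hhit (k - j) p p' hm hGy z'
    ⟨hG.le_left.trans hz'.1, hz'.2.trans_le hG.right_le⟩
  have hiq : i ≤ K * q := hi.le.trans (Nat.mul_le_mul_left K (by omega))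
  have h1 := h.pow_sub_eq_of_free hGy.le_left hGy.right_le hGy.free le_rfl hyG
  have h2 := h.pow_sub_eq_of_free hGy.le_left hGy.right_le hGy.free le_rfl hiG
  have hcomm : (T ^ (k - j)) ((T ^ i) z') = (T ^ i) z := by
    rw [← hret, ← Equiv.Perm.mul_apply, ← Equiv.Perm.mul_apply, ← pow_add, ← pow_add, add_comm]
  rw [hcomm, htr hiq hz, htr hiq hz'] at h2
  linarith

/-- Linear recurrence: every orbit visits `(u, v)` within a time `O(1 / (v - u))`. -/
theorem exists_pow_mem_Ioo (h : IsIET s l r len π T) (hreg : IsRegularIET s l len T)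
    (hs : 2 ≤ s) {c : ℝ} (hc : 0 < c)
    (hlow : ∀ N a b, 1 ≤ N → IsGap l r len T N a b → c / (N : ℝ) ≤ b - a) :
    ∃ C : ℝ, 0 < C ∧ ∀ u v, l ≤ u → u < v → v ≤ r → ∀ z ∈ Ico l r,
      ∃ k : ℕ, (k : ℝ) ≤ C / (v - u) ∧ (T ^ k) z ∈ Ioo u v := by
  obtain ⟨K, hK, hhit⟩ := h.exists_pow_mem_of_isGap hreg hs hc hlow
  have hL : 0 < r - l := sub_pos.2 h.1
  have hK' : (0 : ℝ) < K := by exact_mod_cast hK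
  refine ⟨5 * K ^ 2 * (r - l), by positivity, fun u v hlu huv hvr z hz => ?_⟩
  have hη : 0 < v - u := sub_pos.2 huv
  set q := ⌈3 * (r - l) / (v - u)⌉₊ + 1 with hq
  have hq1 : 3 * (r - l) / (v - u) < q := by
    rw [hq]
    push_cast
    linarith [Nat.le_ceil (3 * (r - l) / (v - u))]
  have hone : 1 ≤ (r - l) / (v - u) := by rw [le_div_iff₀ hη]; linarith
  have hq2 : (q : ℝ) ≤ 5 * ((r - l) / (v - u)) := by
    rw [hq]
    push_cast
    have := Nat.ceil_lt_add_one (a := 3 * (r - l) / (v - u)) (by positivity)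
    rw [mul_div_assoc] at this ⊢
    linarith
  have hKq : 1 ≤ K * q := Nat.mul_pos hK (Nat.succ_pos _)
  obtain ⟨a, b, hG, hmG⟩ := h.exists_isGap (by omega) hKq (x := (u + v) / 2)
    ⟨by linarith, by linarith⟩
  have hGle := h.mul_gap_le hreg hs hhit hK hG
  have hGlt : b - a < (v - u) / 3 := by
    rw [div_lt_iff₀ hη] at hq1
    by_contra! hge
    have : (q : ℝ) * ((v - u) / 3) ≤ q * (b - a) := by gcongr
    linarith
  obtain ⟨k, hk, hkG⟩ := hhit (K * q) a b hKq hG z hz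
  refine ⟨k, ?_, by linarith [hkG.1, hmG.2], by linarith [hkG.2, hmG.1]⟩
  have hk' : (k : ℝ) ≤ K * (K * q) := by exact_mod_cast hk.le
  calc (k : ℝ) ≤ K * (K * q) := hk'
    _ ≤ K * (K * (5 * ((r - l) / (v - u)))) := by gcongr
    _ = 5 * K ^ 2 * (r - l) / (v - u) := by ring

end IsIET

end Keane

/-! ### Heights along orbits and the reduced complexity -/

section Height

variable {s : ℕ} {l r : ℝ} {len : Fin s → ℝ} {π : Equiv.Perm (Fin s)} {T : Equiv.Perm ℝ} {d : ℤ}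

theorem DefinedOverZ.exists_heightLE (hdef : DefinedOverZ d s l r len π) :
    ∃ A : ℝ, 1 ≤ A ∧ HeightLE d A r ∧ ∀ i, HeightLE d A (sepPt l len i) ∧
      HeightLE d A (imgPt l len π i - sepPt l len i) := by
  obtain ⟨-, hr, hi⟩ := hdef
  obtain ⟨Br, hBr⟩ := _root_.exists_heightLE hr
  choose B hB using fun i => _root_.exists_heightLE (hi i).1
  choose C hC using fun i => _root_.exists_heightLE (hi i).2
  have hnn : ∀ i, 0 ≤ B i ∧ 0 ≤ C i := fun i =>
    ⟨(abs_nonneg _).trans (hB i).choose_spec.choose_spec.2.1,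
      (abs_nonneg _).trans (hC i).choose_spec.choose_spec.2.1⟩
  have hBs : 0 ≤ ∑ i, B i := Finset.sum_nonneg fun i _ => (hnn i).1
  have hCs : 0 ≤ ∑ i, C i := Finset.sum_nonneg fun i _ => (hnn i).2
  have hrn : 0 ≤ Br := (abs_nonneg _).trans hBr.choose_spec.choose_spec.2.1
  refine ⟨1 + Br + ∑ i, B i + ∑ i, C i, by linarith, hBr.mono (by linarith),
    fun i => ⟨(hB i).mono ?_, (hC i).mono ?_⟩⟩
  · linarith [Finset.single_le_sum (fun i _ => (hnn i).1) (Finset.mem_univ i)]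
  · linarith [Finset.single_le_sum (fun i _ => (hnn i).2) (Finset.mem_univ i)]

namespace IsIET

theorem apply_eq_or (h : IsIET s l r len π T) (x : ℝ) :
    T x = x ∨ ∃ i, T x = x + (imgPt l len π i - sepPt l len i) := by
  by_cases hx : x ∈ Ico l r
  · obtain ⟨i, hi⟩ := h.exists_mem hx
    exact Or.inr ⟨i, h.apply_eq hi⟩
  · exact Or.inl (h.2.2.2.1 x hx)

variable {A B x : ℝ}

theorem heightLE_pow (h : IsIET s l r len π T) (hA : 0 ≤ A)
    (hα : ∀ i, HeightLE d A (imgPt l len π i - sepPt l len i)) (hx : HeightLE d B x) (k : ℕ) :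
    HeightLE d (B + k * A) ((T ^ k) x) := by
  induction k with
  | zero => simpa using hx
  | succ k ih =>
    rw [pow_succ', Equiv.Perm.mul_apply]
    have e : B + (k + 1 : ℕ) * A = B + k * A + A := by push_cast; ring
    rw [e]
    rcases h.apply_eq_or ((T ^ k) x) with hT | ⟨i, hT⟩ <;> rw [hT]
    · exact ih.mono (by linarith)
    · exact ih.add (hα i)

theorem heightLE_pow_symm (h : IsIET s l r len π T) (hA : 0 ≤ A)
    (hα : ∀ i, HeightLE d A (imgPt l len π i - sepPt l len i)) (hx : HeightLE d B x) (k : ℕ) :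
    HeightLE d (B + k * A) ((T ^ k).symm x) := by
  induction k with
  | zero =>
    have e : (T ^ 0).symm x = x := by rw [Equiv.symm_apply_eq]; simp
    rw [e]
    simpa using hx
  | succ k ih =>
    have e : B + (k + 1 : ℕ) * A = B + k * A + A := by push_cast; ring
    have hy : T ((T ^ (k + 1)).symm x) = (T ^ k).symm x := by
      rw [Equiv.eq_symm_apply, ← Equiv.Perm.mul_apply, ← pow_succ, Equiv.apply_symm_apply]
    rw [e]
    rw [← hy] at ih
    rcases h.apply_eq_or ((T ^ (k + 1)).symm x) with hT | ⟨i, hT⟩ <;> rw [hT] at ih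
    · exact ih.mono (by linarith)
    · have := ih.add (hα i).neg
      rwa [add_neg_cancel_right] at this

theorem heightLE_zpow (h : IsIET s l r len π T) (hA : 0 ≤ A)
    (hα : ∀ i, HeightLE d A (imgPt l len π i - sepPt l len i)) (hx : HeightLE d B x) (k : ℤ) :
    HeightLE d (B + |(k : ℝ)| * A) ((T ^ k) x) := by
  obtain ⟨n, rfl | rfl⟩ := k.eq_nat_or_neg
  · simpa using h.heightLE_pow hA hα hx n
  · rw [zpow_neg, zpow_natCast]
    simpa using h.heightLE_pow_symm hA hα hx n

/-- Over `ℤ[√d]`, gaps of order `N` have length `≫ 1 / N`. -/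
theorem div_le_gap (h : IsIET s l r len π T) (hd : 2 ≤ d) (hsf : Squarefree d) (hA : 1 ≤ A)
    (hr : HeightLE d A r) (hγ : ∀ i, HeightLE d A (sepPt l len i))
    (hα : ∀ i, HeightLE d A (imgPt l len π i - sepPt l len i)) {N : ℕ} (hN : 1 ≤ N) {a b : ℝ}
    (hG : IsGap l r len T N a b) :
    1 / (2 * A * (1 + Real.sqrt d)) / (N : ℝ) ≤ b - a := by
  have hN' : (1 : ℝ) ≤ N := by exact_mod_cast hN
  have hpre : ∀ w ∈ preSep l len T N, HeightLE d (N * A) w := by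
    rintro w ⟨i, k, hk, hw⟩
    rw [← Equiv.eq_symm_apply] at hw
    rw [hw]
    refine (h.heightLE_pow_symm (by linarith) hα (hγ i) k).mono ?_
    have : (k : ℝ) + 1 ≤ N := by exact_mod_cast hk
    nlinarith
  have hb : HeightLE d (N * A) b := by
    rcases hG.right_mem with hb | rfl
    · exact hpre b hb
    · exact hr.mono (by nlinarith)
  have key := (hpre a hG.left_mem).one_le_sub_mul hd hsf hb hG.lt
  have := Real.sqrt_nonneg (d : ℝ)
  rw [div_div, div_le_iff₀ (by positivity)]
  linarith

theorem exists_abs_le_of_mem_divPoints (h : IsIET s l r len π T) {C u v : ℝ}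
    (hC : 0 ≤ C) (hhit : ∀ z ∈ Ico l r, ∃ k : ℕ, (k : ℝ) ≤ C ∧ (T ^ k) z ∈ Ioo u v) {w : ℝ}
    (hw : w ∈ divPoints s l len T u v) :
    ∃ (i : Fin s) (k : ℤ), |(k : ℝ)| ≤ C + 1 ∧ w = (T ^ k) (sepPt l len i) := by
  obtain ⟨i, k, hk1, hk2, rfl⟩ := mem_iUnion.1 hw
  refine ⟨i, k, ?_, rfl⟩
  have hplus : (rhoPlusPt T u v (sepPt l len i) : ℝ) ≤ C + 1 := by
    obtain ⟨n, hn, hnJ⟩ := hhit _ (h.apply_mem_iff.2 (h.sepPt_mem i))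
    rw [← Equiv.Perm.mul_apply, ← pow_succ] at hnJ
    have h1 : rhoPlusPt T u v (sepPt l len i) ≤ n + 1 := Nat.sInf_le ⟨Nat.succ_pos n, hnJ⟩
    have h2 : (rhoPlusPt T u v (sepPt l len i) : ℝ) ≤ n + 1 := by exact_mod_cast h1
    linarith
  have hminus : (rhoMinusPt T u v (sepPt l len i) : ℝ) ≤ C := by
    set M := ⌊C⌋₊ with hM
    obtain ⟨n, hn, hnJ⟩ := hhit ((T ^ M).symm (sepPt l len i)) (by
      rw [← h.pow_apply_mem_iff M, Equiv.apply_symm_apply]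
      exact h.sepPt_mem i)
    have hnM : n ≤ M := Nat.le_floor hn
    have e : (T⁻¹ ^ (M - n)) (sepPt l len i) = (T ^ n) ((T ^ M).symm (sepPt l len i)) := by
      rw [inv_pow, Equiv.Perm.inv_eq_iff_eq, ← Equiv.Perm.mul_apply, ← pow_add,
        Nat.sub_add_cancel hnM, Equiv.apply_symm_apply]
    have h1 : rhoMinusPt T u v (sepPt l len i) ≤ M - n := by
      refine Nat.sInf_le ?_
      rw [mem_ofPred_eq, e]
      exact hnJ
    calc (rhoMinusPt T u v (sepPt l len i) : ℝ) ≤ M := by exact_mod_cast h1.trans (Nat.sub_le M n)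
      _ ≤ C := Nat.floor_le hC
  have hk1' : -(rhoMinusPt T u v (sepPt l len i) : ℝ) ≤ k := by exact_mod_cast hk1
  have hk2' : (k : ℝ) < rhoPlusPt T u v (sepPt l len i) := by exact_mod_cast hk2
  exact abs_le.2 ⟨by linarith, by linarith⟩

end IsIET

theorem piSet_Ico {u v : ℝ} (huv : u < v) :
    PiSet d (Ico u v) = (v - u) * (max (PsiNum d u) (PsiNum d v) : ℕ) := by
  have h1 : PsiSet d (Ico u v) = max (PsiNum d u) (PsiNum d v) := by
    rw [PsiSet, frontier_Ico huv, image_pair, csSup_pair]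
  rw [PiSet, h1, Real.volume_Ico, ENNReal.toReal_ofReal (sub_nonneg.2 huv.le)]

/-- The norm of a nonzero element of `ℤ[√d]` is at least `1`, so the reduced complexity of a
semi-interval with endpoints in `ℤ[√d]` is bounded below. -/
theorem le_piSet_Ico (hd : 2 ≤ d) (hsf : Squarefree d) {u v : ℝ} (huv : u < v)
    (hu : u ∈ Zsd d) (hv : v ∈ Zsd d) : 1 / (4 * Real.sqrt d) ≤ PiSet d (Ico u v) := by
  rw [piSet_Ico huv]
  set P := max (PsiNum d u) (PsiNum d v)
  have hu' : HeightLE d P u := (heightLE_psiNum hu).mono (by exact_mod_cast le_max_left _ _)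
  have hv' : HeightLE d P v := (heightLE_psiNum hv).mono (by exact_mod_cast le_max_right _ _)
  have key := hu'.one_le_sub_mul hd hsf hv' huv
  have hq : 1 ≤ Real.sqrt d := Real.one_le_sqrt.2 (by exact_mod_cast (by omega : (1 : ℤ) ≤ d))
  have hnn : 0 ≤ (v - u) * (P : ℝ) := mul_nonneg (sub_nonneg.2 huv.le) (Nat.cast_nonneg P)
  rw [div_le_iff₀ (by positivity)]
  nlinarith

end Height

/-- For a regular interval exchange transformation defined over
`ℤ[√d]`, `Π(J) = Θ(1)` over admissible semi-intervals `J`: every admissible `J`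
has endpoints in `ℤ[√d] ∪ {r}` and `1/(4√d) ≤ Π(J) ≤ c₂` for a constant `c₂`
depending only on `T`. -/
theorem piSet_admissible_theta_one (d : ℤ) (hd : 2 ≤ d) (hsf : Squarefree d)
    (s : ℕ) (hs : 2 ≤ s) (l r : ℝ) (len : Fin s → ℝ) (π : Equiv.Perm (Fin s))
    (T : Equiv.Perm ℝ) (hIET : IsIET s l r len π T)
    (hreg : IsRegularIET s l len T) (hdef : DefinedOverZ d s l r len π) :
    ∃ c₂ : ℝ, 0 < 1 / (4 * Real.sqrt d) ∧ 1 / (4 * Real.sqrt d) ≤ c₂ ∧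
      ∀ u v : ℝ, Admissible s l r len T u v →
        (u ∈ Zsd d ∧ (v ∈ Zsd d ∨ v = r)) ∧
        1 / (4 * Real.sqrt d) ≤ PiSet d (Set.Ico u v) ∧
        PiSet d (Set.Ico u v) ≤ c₂ := by
  obtain ⟨A, hA, hr, hγα⟩ := hdef.exists_heightLE
  have hγ := fun i => (hγα i).1
  have hα := fun i => (hγα i).2
  have hq : 0 < Real.sqrt d := Real.sqrt_pos.2 (by exact_mod_cast (by omega : (0 : ℤ) < d))
  obtain ⟨C, hC, hhit⟩ := hIET.exists_pow_mem_Ioo hreg hs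
    (c := 1 / (2 * A * (1 + Real.sqrt d))) (by positivity)
    fun N a b hN hG => hIET.div_le_gap hd hsf hA hr hγ hα hN hG
  refine ⟨max (A * (2 * (r - l) + C)) (1 / (4 * Real.sqrt d)), by positivity, le_max_right _ _,
    fun u v ⟨hlu, huv, hvr, hu, hv⟩ => ?_⟩
  have hη : 0 < v - u := sub_pos.2 huv
  have hCη : 0 < C / (v - u) := div_pos hC hη
  have hht : ∀ w ∈ divPoints s l len T u v ∪ {r}, HeightLE d (A * (2 + C / (v - u))) w := by
    rintro w (hw | rfl)
    · obtain ⟨i, k, hk, rfl⟩ := hIET.exists_abs_le_of_mem_divPoints hCη.le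
        (hhit u v hlu huv hvr) hw
      refine (hIET.heightLE_zpow (by linarith) hα (hγ i) k).mono ?_
      nlinarith
    · exact hr.mono (by nlinarith)
  have hu' := hht u hu
  have hv' := hht v hv
  refine ⟨⟨hu'.mem_Zsd, Or.inl hv'.mem_Zsd⟩,
    le_piSet_Ico hd hsf huv hu'.mem_Zsd hv'.mem_Zsd, le_max_of_le_left ?_⟩
  rw [piSet_Ico huv, Nat.cast_max]
  calc (v - u) * max (PsiNum d u : ℝ) (PsiNum d v)
      ≤ (v - u) * (A * (2 + C / (v - u))) := by
        gcongr
        exact max_le hu'.psiNum_le hv'.psiNum_le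
    _ = A * (2 * (v - u) + C) := by field_simp
    _ ≤ A * (2 * (r - l) + C) := by gcongr

end
end
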